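/- arXiv:2510.00889 — 6 statements merged into one kernel-verified Lean document; each statement's English description precedes it below -/
import Mathlib

section
/- Let r > 2. The word w = x_1 x_2 x_3 ⋯ x_{r−1} x_r² x_{r−1} ⋯ x_3 x_2 x_1⁻¹ ∈ F_r (of length 2r) is primitivity-blocking, and it is a shortest primitivity-blocking word in F_r: every element of F_r whose reduced word has length less than 2r is not primitivity-blocking. -/
/-- `FG r` is the free group `F_r` of rank `r`, with free generating set
`x_1, …, x_r` given by `FreeGroup.of 0, …, FreeGroup.of (r-1)`. -/
abbrev FG (r : ℕ) := FreeGroup (Fin r)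

/-- `|w|`, the length of the reduced word representing `w`. -/
def wordLength {r : ℕ} (w : FG r) : ℕ := w.toWord.length

/-- `w` is cyclically reduced: its reduced word is empty, or its first letter is not
the inverse of its last letter.  (A letter `(i, b)` has inverse `(i, !b)`.) -/
def CyclicallyReduced {r : ℕ} (w : FG r) : Prop :=
  ∀ a ∈ w.toWord.head?, ∀ b ∈ w.toWord.getLast?, a ≠ (b.1, !b.2)

/-- `p` is a primitive element of `F_r`: the image of `x_1` under some automorphism. -/
def Primitive {r : ℕ} (hr : 0 < r) (p : FG r) : Prop :=
  ∃ φ : FG r ≃* FG r, φ (FreeGroup.of ⟨0, hr⟩) = p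

/-- `v` is primitivity-blocking: the reduced word of `v` is not an infix of the reduced
word of any cyclically reduced primitive element of `F_r`. -/
def PrimitivityBlocking {r : ℕ} (hr : 0 < r) (v : FG r) : Prop :=
  ∀ p : FG r, Primitive hr p → CyclicallyReduced p → ¬ v.toWord <:+: p.toWord

/-- `v` is `w`-orbit-blocking: for every automorphism `φ` with `φ w` cyclically reduced,
the reduced word of `v` is not an infix of the reduced word of `φ w`. -/
def OrbitBlocking {r : ℕ} (w v : FG r) : Prop :=
  ∀ φ : FG r ≃* FG r, CyclicallyReduced (φ w) → ¬ v.toWord <:+: (φ w).toWord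

/-- `u` is positive: every letter of its reduced word is a generator (not an inverse). -/
def Positive {r : ℕ} (u : FG r) : Prop := ∀ l ∈ u.toWord, l.2 = true

/-- The cyclic length `‖u‖`: the minimum of `|g u g⁻¹|` over all `g`. -/
noncomputable def cyclicLength {r : ℕ} (u : FG r) : ℕ :=
  sInf (Set.range fun g : FG r => wordLength (g * u * g⁻¹))

/-- `gen r j` is the generator `x_{j+1}` of `F_r` (0-indexed: the `j`-th generator),
for `j < r`. -/
def gen (r : ℕ) (j : ℕ) : FG r :=
  if h : j < r then FreeGroup.of ⟨j, h⟩ else 1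

/-- `(b_1, …, b_r)` is a basis of `F_r`: some automorphism sends `x_i` to `b_i`. -/
def IsBasis {r : ℕ} (b : Fin r → FG r) : Prop :=
  ∃ φ : FG r ≃* FG r, ∀ i, φ (FreeGroup.of i) = b i

/-- The word `x_1 x_2 ⋯ x_{r-1} x_r² x_{r-1} ⋯ x_3 x_2 x_1⁻¹` of `F_r`. -/
def w8 (r : ℕ) : FG r :=
  ((List.range r).map (gen r)).prod *
    ((List.range (r - 1)).reverse.map (fun j => gen r (j + 1))).prod * (gen r 0)⁻¹

namespace PrimitiveWord

open List
open FreeGroup hiding map_mul map_inv map_one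

section Letters

variable {α : Type*}

/-- The inverse of a letter. -/
def linv (a : α × Bool) : α × Bool := (a.1, !a.2)

@[simp] lemma linv_linv (a : α × Bool) : linv (linv a) = a := by simp [linv]

@[simp] lemma linv_fst (a : α × Bool) : (linv a).1 = a.1 := rfl

lemma linv_injective : Function.Injective (linv (α := α)) :=
  Function.LeftInverse.injective linv_linv

lemma linv_ne (a : α × Bool) : linv a ≠ a := fun h => by simpa [linv] using congrArg Prod.snd h

lemma ne_linv_iff {a b : α × Bool} : a ≠ linv b ↔ (a.1 = b.1 → a.2 = b.2) := by
  obtain ⟨a, c⟩ := a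
  obtain ⟨b, d⟩ := b
  cases c <;> cases d <;> simp [linv]

lemma ne_linv_comm {a b : α × Bool} : a ≠ linv b ↔ b ≠ linv a := by
  rw [ne_linv_iff, ne_linv_iff]
  grind

lemma isReduced_iff_ne_linv {L : List (α × Bool)} :
    IsReduced L ↔ L.IsChain fun a b => a ≠ linv b :=
  IsChain.iff fun _ _ => ne_linv_iff.symm

lemma isReduced_pair_iff {a b : α × Bool} : IsReduced [a, b] ↔ a ≠ linv b := by
  simp [isReduced_iff_ne_linv]

lemma isCyclicallyReduced_iff_append_self {L : List (α × Bool)} :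
    IsCyclicallyReduced L ↔ IsReduced (L ++ L) := by
  rw [isCyclicallyReduced_iff, FreeGroup.IsReduced, FreeGroup.IsReduced, isChain_append]
  tauto

lemma mk_cons (a : α × Bool) (L : List (α × Bool)) : mk (a :: L) = mk [a] * mk L := by
  simp [mul_mk]

lemma mk_linv (a : α × Bool) : mk [linv a] = (mk [a])⁻¹ := by simp [linv, inv_mk, invRev]

lemma mk_true (i : α) : (mk [(i, true)] : FreeGroup α) = of i := rfl

lemma mk_false (i : α) : (mk [(i, false)] : FreeGroup α) = (of i)⁻¹ := rfl

lemma toWord_mk_of_isReduced [DecidableEq α] {L : List (α × Bool)} (h : IsReduced L) :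
    (mk L).toWord = L := by rw [toWord_mk, h.reduce_eq]

/-- A homomorphism fixing all generators but `x_i` fixes every word in which `x_i` does
not occur. -/
lemma map_mk_of_forall_ne {f : FreeGroup α →* FreeGroup α} {i : α}
    (hf : ∀ j, j ≠ i → f (of j) = of j) :
    ∀ {L : List (α × Bool)}, (∀ l ∈ L, l.1 ≠ i) → f (mk L) = mk L
  | [], _ => by simp [← one_eq_mk]
  | (j, b) :: L, h => by
    rw [mk_cons, map_mul, map_mk_of_forall_ne hf fun l hl => h l (mem_cons_of_mem _ hl)]
    congr 1
    have hj := hf j (h (j, b) mem_cons_self)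
    cases b
    · rw [mk_false, map_inv, hj]
    · rw [mk_true, hj]

/-- If `x_i` occurs neither in `A` nor in `B`, then `x_i ↦ A x_i B` extends to an automorphism
fixing all other generators. -/
lemma exists_mulEquiv_of_forall_ne [DecidableEq α] {i : α} {A B : List (α × Bool)}
    (hA : ∀ l ∈ A, l.1 ≠ i) (hB : ∀ l ∈ B, l.1 ≠ i) :
    ∃ φ : FreeGroup α ≃* FreeGroup α,
      φ (of i) = mk A * of i * mk B ∧ ∀ j, j ≠ i → φ (of j) = of j := by
  let f (a b : FreeGroup α) : FreeGroup α →* FreeGroup α :=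
    FreeGroup.lift fun j => if j = i then a * of i * b else of j
  have f_ne (a b : FreeGroup α) (j : α) (hj : j ≠ i) : f a b (of j) = of j := by
    simp [f, hj]
  have f_self (a b : FreeGroup α) : f a b (of i) = a * of i * b := by simp [f]
  have comp (a b c d : FreeGroup α) (ha : f c d a = a) (hb : f c d b = b) (hac : a * c = 1)
      (hdb : d * b = 1) : (f c d).comp (f a b) = MonoidHom.id _ := by
    ext j
    by_cases hj : j = i
    · subst hj
      have h : a * (c * of j * d) * b = (a * c) * of j * (d * b) := by group
      simp [f_self, ha, hb, h, hac, hdb]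
    · simp [f_ne _ _ j hj]
  have fixA (c d : FreeGroup α) : f c d (mk A) = mk A := map_mk_of_forall_ne (f_ne c d) hA
  have fixB (c d : FreeGroup α) : f c d (mk B) = mk B := map_mk_of_forall_ne (f_ne c d) hB
  refine ⟨MonoidHom.toMulEquiv (f (mk A) (mk B)) (f (mk A)⁻¹ (mk B)⁻¹)
    (comp _ _ _ _ (fixA _ _) (fixB _ _) (mul_inv_cancel _) (inv_mul_cancel _))
    (comp _ _ _ _ (by rw [map_inv, fixA]) (by rw [map_inv, fixB]) (inv_mul_cancel _)
      (mul_inv_cancel _)), ?_, ?_⟩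
  · exact f_self _ _
  · exact f_ne _ _

end Letters

section Primitive

variable {r : ℕ} {hr : 0 < r} {p : FG r}

lemma primitive_of (i : Fin r) : Primitive hr (of i) :=
  ⟨freeGroupCongr (Equiv.swap ⟨0, hr⟩ i), by simp [freeGroupCongr]⟩

lemma _root_.Primitive.map (hp : Primitive hr p) (φ : FG r ≃* FG r) : Primitive hr (φ p) := by
  obtain ⟨ψ, rfl⟩ := hp
  exact ⟨ψ.trans φ, rfl⟩

lemma _root_.Primitive.conj (hp : Primitive hr p) (g : FG r) : Primitive hr (g * p * g⁻¹) :=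
  hp.map (MulAut.conj g)

lemma _root_.Primitive.inv (hp : Primitive hr p) : Primitive hr p⁻¹ := by
  obtain ⟨φ, rfl⟩ := hp
  let f : FG r →* FG r := FreeGroup.lift fun j => (of j)⁻¹
  have hf : f.comp f = MonoidHom.id _ := by ext; simp [f]
  refine ⟨(MonoidHom.toMulEquiv f f hf hf).trans φ, ?_⟩
  rw [MulEquiv.trans_apply, ← map_inv]
  congr 1

/-- A word in which some generator occurs exactly once, with exponent `±1`, represents a primitive
element. -/
lemma primitive_mk_of_forall_ne {i : Fin r} {A B : List (Fin r × Bool)}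
    (hA : ∀ l ∈ A, l.1 ≠ i) (hB : ∀ l ∈ B, l.1 ≠ i) (b : Bool) :
    Primitive hr (mk (A ++ (i, b) :: B)) := by
  have key {A B : List (Fin r × Bool)} (hA : ∀ l ∈ A, l.1 ≠ i) (hB : ∀ l ∈ B, l.1 ≠ i) :
      Primitive hr (mk (A ++ (i, true) :: B)) := by
    obtain ⟨φ, hφ, -⟩ := exists_mulEquiv_of_forall_ne hA hB
    have h := (primitive_of (hr := hr) i).map φ
    rwa [hφ, ← mk_true, mul_mk, mul_mk, append_assoc] at h
  cases b
  · have h : ∀ {L : List (Fin r × Bool)}, (∀ l ∈ L, l.1 ≠ i) → ∀ l ∈ invRev L, l.1 ≠ i := by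
      intro L hL l hl
      simp only [invRev, mem_reverse, mem_map] at hl
      obtain ⟨l', hl', rfl⟩ := hl
      exact hL l' hl'
    have h' := (key (h hB) (h hA)).inv
    rw [inv_mk, invRev_append, invRev_cons, invRev_invRev, invRev_invRev] at h'
    simpa [invRev] using h'
  · exact key hA hB

lemma cyclicallyReduced_iff : CyclicallyReduced p ↔ IsCyclicallyReduced p.toWord := by
  rw [isCyclicallyReduced_iff, CyclicallyReduced]
  have h (a b : Fin r × Bool) : a ≠ (b.1, !b.2) ↔ (b.1 = a.1 → b.2 = a.2) := by
    rw [← ne_linv_iff, ne_linv_comm]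
    rfl
  simp only [h, isReduced_toWord, true_and]
  exact ⟨fun H a ha b hb => H b hb a ha, fun H a ha b hb => H b hb a ha⟩

lemma exists_countP_le_one {L : List (Fin r × Bool)} (h : L.length < 2 * r) :
    ∃ i : Fin r, L.countP (fun l => l.1 = i) ≤ 1 := by
  by_contra! H
  have h1 : ∑ i : Fin r, L.countP (fun l => l.1 = i) = L.length := by
    clear h H
    induction L with
    | nil => simp
    | cons a L ih => simp [countP_cons, Finset.sum_add_distrib, ih]
  have h2 : ∑ i : Fin r, 2 ≤ ∑ i : Fin r, L.countP (fun l => l.1 = i) :=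
    Finset.sum_le_sum fun i _ => H i
  simp at h2
  omega

lemma not_primitivityBlocking_of_length_lt (hr2 : 2 < r) {u : FG r} (hu : wordLength u < 2 * r) :
    ¬ PrimitivityBlocking hr u := by
  obtain ⟨i, hi⟩ := exists_countP_le_one hu
  -- It suffices to append one letter to `u`.
  suffices H : ∃ c : Fin r × Bool, Primitive hr (mk (u.toWord ++ [c])) ∧
      (∀ a ∈ u.toWord.head?, c ≠ linv a) ∧ ∀ a ∈ u.toWord.getLast?, a ≠ linv c by
    obtain ⟨c, hc, hhead, hlast⟩ := H
    have hred : IsReduced (u.toWord ++ [c]) := by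
      rw [isReduced_iff_ne_linv, isChain_append]
      exact ⟨isReduced_iff_ne_linv.1 isReduced_toWord, isChain_singleton _, by simpa using hlast⟩
    intro hb
    refine hb _ hc ?_ ?_
    · rw [cyclicallyReduced_iff, toWord_mk_of_isReduced hred, isCyclicallyReduced_iff]
      refine ⟨hred, ?_⟩
      rw [getLast?_concat, head?_append]
      rintro a ⟨⟩ b hb
      rw [← ne_linv_iff]
      cases h : u.toWord.head? with
      | none => simp_all [(linv_ne _).symm]
      | some x => exact hhead b (by simpa [h] using hb)
    · rw [toWord_mk_of_isReduced hred]
      exact (prefix_append _ _).isInfix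
  by_cases h0 : ∀ l ∈ u.toWord, l.1 ≠ i
  · refine ⟨(i, true), primitive_mk_of_forall_ne h0 (by simp) true, ?_, ?_⟩
    · rintro a ha h
      exact h0 a (mem_of_mem_head? ha) (congrArg Prod.fst h).symm
    · rintro a ha h
      exact h0 a (mem_of_mem_getLast? ha) (congrArg Prod.fst h)
  · push Not at h0
    obtain ⟨⟨i', b⟩, hl, rfl⟩ := h0
    obtain ⟨A, B, hAB⟩ := append_of_mem hl
    rw [hAB] at hi
    simp only [countP_append, countP_cons, decide_true, if_true] at hi
    have hA : A.countP (fun l => l.1 = i') = 0 := by omega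
    have hB : B.countP (fun l => l.1 = i') = 0 := by omega
    rw [countP_eq_zero] at hA hB
    -- A letter with index other than `i'` cancelling with neither end of `u`.
    have hne : u.toWord ≠ [] := by simp [hAB]
    set a := u.toWord.head hne
    set z := u.toWord.getLast hne
    have hcard : ((Finset.univ.erase i' ×ˢ Finset.univ : Finset (Fin r × Bool)) \
        {linv a, linv z}).Nonempty := by
      rw [← Finset.card_pos]
      have h1 := Finset.le_card_sdiff ({linv a, linv z} : Finset (Fin r × Bool))
        (Finset.univ.erase i' ×ˢ Finset.univ)
      have h2 := Finset.card_le_two (a := linv a) (b := linv z)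
      simp only [Finset.card_product, Finset.card_erase_of_mem (Finset.mem_univ _),
        Finset.card_univ, Fintype.card_fin, Fintype.card_bool] at h1
      omega
    obtain ⟨c, hc⟩ := hcard
    simp only [Finset.mem_sdiff, Finset.mem_product, Finset.mem_erase, Finset.mem_univ,
      Finset.mem_insert, Finset.mem_singleton, and_true, not_or] at hc
    refine ⟨c, ?_, ?_, ?_⟩
    · rw [hAB, append_assoc, cons_append]
      refine primitive_mk_of_forall_ne (by simpa using hA) ?_ b
      intro l hl
      rcases mem_append.1 hl with hl | hl
      · simpa using hB l hl
      · rw [mem_singleton.1 hl]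
        exact hc.1
    · rw [head?_eq_some_head hne]
      rintro _ ⟨⟩
      exact hc.2.1
    · rw [getLast?_eq_some_getLast hne]
      rintro _ ⟨⟩
      exact ne_linv_comm.1 hc.2.2

end Primitive

section Coloring

variable {α : Type*}

section EvConst

variable [DecidableEq α] {c : FreeGroup α → Bool} {L : List (α × Bool)}

/-- The coloring `c` takes the value `k` at all but finitely many elements whose reduced word
starts with `L`. -/
def EvConst (c : FreeGroup α → Bool) (L : List (α × Bool)) (k : Bool) : Prop :=
  {h : FreeGroup α | L <+: h.toWord ∧ c h ≠ k}.Finite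

lemma evConst_of_le_length {N : ℕ} (hc : ∀ g : FreeGroup α, N ≤ g.norm → ∀ l, c (g * mk [l]) = c g)
    (hN : N ≤ L.length) : EvConst c L (c (mk L)) := by
  have key (t : List (α × Bool)) (ht : IsReduced (L ++ t)) : c (mk (L ++ t)) = c (mk L) := by
    induction t using List.reverseRecOn with
    | nil => simp
    | append_singleton t l ih =>
      have ht' : IsReduced (L ++ t) := ht.infix ⟨[], [l], by simp⟩
      rw [← append_assoc, ← mul_mk, hc, ih ht']
      rw [FreeGroup.norm, toWord_mk_of_isReduced ht', length_append]
      omega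
  refine Set.finite_empty.subset ?_
  rintro h ⟨⟨t, ht⟩, hne⟩
  refine hne ?_
  have := key t (ht ▸ isReduced_toWord)
  rwa [ht, mk_toWord] at this

/-- A coloring of the Cayley tree with finite coboundary which is not eventually constant is
eventually constant on every branch at some vertex, but not around that vertex. -/
lemma exists_branching {N : ℕ} (hc : ∀ g : FreeGroup α, N ≤ g.norm → ∀ l, c (g * mk [l]) = c g)
    (h : ∀ k, ¬ EvConst c [] k) :
    ∃ L, IsReduced L ∧ (∀ k, ¬ EvConst c L k) ∧
      ∀ l, IsReduced (L ++ [l]) → ∃ k, EvConst c (L ++ [l]) k := by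
  by_contra! H
  have key (n : ℕ) : ∃ L : List (α × Bool), IsReduced L ∧ L.length = n ∧ ∀ k, ¬ EvConst c L k := by
    induction n with
    | zero => exact ⟨[], IsReduced.nil, rfl, h⟩
    | succ n ih =>
      obtain ⟨L, hL, hn, hk⟩ := ih
      obtain ⟨l, hl, hlk⟩ := H L hL hk
      exact ⟨L ++ [l], hl, by simp [hn], hlk⟩
  obtain ⟨L, -, hn, hk⟩ := key N
  exact hk _ (evConst_of_le_length hc hn.ge)

lemma evConst_of_forall [Finite α] {k : Bool}
    (h : ∀ l, IsReduced (L ++ [l]) → EvConst c (L ++ [l]) k) : EvConst c L k := by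
  refine ((Set.finite_singleton (mk L)).union
    (Set.Finite.biUnion (Set.toFinite {l | IsReduced (L ++ [l])}) h)).subset ?_
  rintro g ⟨⟨t, ht⟩, hg⟩
  cases t with
  | nil =>
    left
    rw [Set.mem_singleton_iff, ← mk_toWord (x := g), ← ht, append_nil]
  | cons l t =>
    right
    have hpre : L ++ [l] <+: g.toWord := ⟨t, by simp [← ht]⟩
    exact Set.mem_biUnion (isReduced_toWord.infix hpre.isInfix) ⟨hpre, hg⟩

/-- If `c` is invariant under right multiplication by `q`, its value on a line of translates of
`q` is the eventual value on every branch the line enters. -/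
lemma eq_of_evConst {q : FreeGroup α} (hq : ∀ g, c (g * q) = c g)
    (hcyc : IsCyclicallyReduced q.toWord)
    {s v : List (α × Bool)} {b : α × Bool} (hqw : q.toWord = s ++ b :: v)
    (hb : IsReduced (L ++ [b])) {k : Bool} (hk : EvConst c (L ++ [b]) k) :
    c (mk (L ++ b :: v)) = k := by
  by_contra hne
  let w (n : ℕ) : List (α × Bool) := L ++ b :: v ++ (replicate n q.toWord).flatten
  have hmk (n : ℕ) : mk (w n) = mk (L ++ b :: v) * q ^ n := by
    have : mk (replicate n q.toWord).flatten = q ^ n := by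
      induction n with
      | zero => simp [one_eq_mk]
      | succ n ih => rw [replicate_succ, flatten_cons, ← mul_mk, ih, mk_toWord, pow_succ']
    rw [← this, mul_mk]
  have hw (n : ℕ) : (mk (w n)).toWord = w n := by
    refine toWord_mk_of_isReduced ?_
    have h1 := (hcyc.flatten_replicate (n + 1)).isReduced
    have h2 : IsReduced ([b] ++ (v ++ (replicate n q.toWord).flatten)) :=
      h1.infix ⟨s, [], by simp [replicate_succ, hqw]⟩
    simpa [w] using hb.append_overlap h2 (by simp)
  have hc (n : ℕ) : c (mk (w n)) = c (mk (L ++ b :: v)) := by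
    rw [hmk]
    induction n with
    | zero => simp
    | succ n ih => rw [pow_succ, ← mul_assoc, hq, ih]
  have hinj : Function.Injective fun n => mk (w n) := by
    intro m n h
    have h' := congrArg (fun g : FreeGroup α => g.toWord.length) h
    simp only [hw] at h'
    simpa [w, hqw] using h'
  refine Set.infinite_range_of_injective hinj (hk.subset ?_)
  rintro _ ⟨n, rfl⟩
  refine ⟨?_, by rwa [hc]⟩
  rw [hw]
  exact ⟨v ++ (replicate n q.toWord).flatten, by simp [w]⟩

end EvConst

lemma toWord_mul_mk_singleton [DecidableEq α] (h : FreeGroup α) (l : α × Bool) :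
    (h * mk [l]).toWord = h.toWord ++ [l] ∨ h.toWord = (h * mk [l]).toWord ++ [linv l] := by
  by_cases H : IsReduced (h.toWord ++ [l])
  · left
    conv_lhs => rw [← mk_toWord (x := h), mul_mk]
    exact toWord_mk_of_isReduced H
  · right
    rcases eq_nil_or_concat h.toWord with h0 | ⟨L, a, hL⟩
    · simp [h0] at H
    · rw [concat_eq_append] at hL
      have hLr : IsReduced (L ++ [a]) := hL ▸ isReduced_toWord
      have ha : a = linv l := by
        by_contra ha
        refine H ?_
        rw [hL]
        exact hLr.append_overlap (isReduced_pair_iff.2 ha) (by simp)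
      have h1 : h * mk [l] = mk L := by
        rw [← mk_toWord (x := h), hL, ha, ← mul_mk, mk_linv, inv_mul_cancel_right]
      rw [h1, toWord_mk_of_isReduced (hLr.infix ⟨[], [a], by simp⟩), hL, ha]

lemma head?_toWord_mul [DecidableEq α] (h k : FreeGroup α) (hk : k.norm < h.norm) :
    (h * k).toWord.head? = h.toWord.head? := by
  obtain ⟨K, rfl⟩ : ∃ K, k = mk K := ⟨_, mk_toWord.symm⟩
  suffices H : ∀ K : List (α × Bool), ∀ h : FreeGroup α, K.length < h.norm →
      (h * mk K).toWord.head? = h.toWord.head? by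
    have := H (mk K).toWord h hk
    rwa [mk_toWord] at this
  clear hk K
  intro K
  induction K with
  | nil => simp [← one_eq_mk]
  | cons l K ih =>
    intro h hlen
    rw [mk_cons, ← mul_assoc]
    rw [FreeGroup.norm, length_cons] at hlen
    rcases toWord_mul_mk_singleton h l with h1 | h1
    · rw [ih _ (by rw [FreeGroup.norm, h1, length_append]; omega), h1, head?_append]
      cases h2 : h.toWord with
      | nil => simp [h2] at hlen
      | cons a t => simp
    · have h2 := congrArg length h1
      rw [length_append, length_singleton] at h2
      rw [ih _ (by rw [FreeGroup.norm]; omega), h1, head?_append]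
      cases h3 : (h * mk [l]).toWord with
      | nil => rw [h3, length_nil] at h2; omega
      | cons a t => simp

/-- Every basis element `φ x_i` has a coloring of the Cayley tree with finite coboundary,
constant on the left cosets of `⟨φ x_i⟩` and not eventually constant. -/
lemma exists_invariant_coloring [DecidableEq α] [Finite α] (φ : FreeGroup α ≃* FreeGroup α)
    {i j : α} (hij : i ≠ j) :
    ∃ (c : FreeGroup α → Bool) (N : ℕ), (∀ g, c (g * φ (of i)) = c g) ∧
      (∀ g : FreeGroup α, N ≤ g.norm → ∀ l, c (g * mk [l]) = c g) ∧ ∀ k, ¬ EvConst c [] k := by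
  let c (g : FreeGroup α) : Bool := decide ((φ.symm g).toWord.head? = some (j, true))
  have hfin (M : ℕ) : {g : FreeGroup α | (φ.symm g).norm ≤ M}.Finite := by
    refine (List.finite_length_le (α × Bool) M).preimage
      (f := fun g => (φ.symm g).toWord) (Set.injOn_of_injective ?_)
    exact toWord_injective.comp φ.symm.injective
  obtain ⟨M, hM⟩ := (Set.finite_range fun l : α × Bool => (φ.symm (mk [l])).norm).bddAbove
  obtain ⟨N, hN⟩ := ((hfin M).image fun g : FreeGroup α => g.norm).bddAbove
  refine ⟨c, N + 1, ?_, ?_, ?_⟩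
  · intro g
    have h : φ.symm (g * φ (of i)) = φ.symm g * mk [(i, true)] := by
      rw [map_mul, MulEquiv.symm_apply_apply, mk_true]
    simp only [c, h, decide_eq_decide]
    rcases toWord_mul_mk_singleton (φ.symm g) (i, true) with h1 | h1
    · rw [h1, head?_append]
      cases (φ.symm g).toWord <;> simp [hij]
    · rw [h1, head?_append]
      cases (φ.symm g * mk [(i, true)]).toWord <;> simp [linv]
  · intro g hg l
    simp only [c]
    rw [map_mul, head?_toWord_mul]
    by_contra hlt
    have h1 := hN (Set.mem_image_of_mem _ ((not_lt.1 hlt).trans (hM ⟨l, rfl⟩)))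
    omega
  · intro k hk
    have hrep (a : α) : Function.Injective fun n : ℕ => φ (of a ^ (n + 1)) := by
      intro m n h
      simpa using congrArg FreeGroup.norm (φ.injective h)
    have hval (a : α) (n : ℕ) : c (φ (of a ^ (n + 1))) = decide (a = j) := by
      simp [c, toWord_of_pow, replicate_succ, -map_pow]
    obtain ⟨a, ha⟩ : ∃ a, decide (a = j) ≠ k := by
      cases k
      · exact ⟨j, by simp⟩
      · exact ⟨i, by simp [hij]⟩
    refine Set.infinite_range_of_injective (hrep a) (hk.subset ?_)
    rintro _ ⟨n, rfl⟩
    exact ⟨nil_prefix, by simpa only [hval] using ha⟩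

/-- **Whitehead's cut vertex lemma**: the Whitehead graph of a cyclically reduced primitive element
is disconnected, or becomes disconnected when a vertex is removed. -/
theorem exists_whitehead_coloring [DecidableEq α] [Finite α] (φ : FreeGroup α ≃* FreeGroup α)
    {i j : α} (hij : i ≠ j) {P : List (α × Bool)} (hP : IsCyclicallyReduced P)
    (hφ : φ (of i) = mk P) :
    ∃ (S : α × Bool → Prop) (κ : α × Bool → Bool), (∀ a b, ¬ S a → ¬ S b → a = b) ∧
      (∀ k, ∃ l, S l ∧ κ l ≠ k) ∧
      ∀ a b, [a, b] <:+: P ++ P → S (linv a) → S b → κ (linv a) = κ b := by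
  obtain ⟨c, N, hci, hcN, hc⟩ := exists_invariant_coloring φ hij
  obtain ⟨L, hL, hLk, hLl⟩ := exists_branching hcN hc
  have hex : ∀ l, ∃ k, IsReduced (L ++ [l]) → EvConst c (L ++ [l]) k := fun l => by
    by_cases h : IsReduced (L ++ [l])
    · exact (hLl l h).imp fun _ hk _ => hk
    · exact ⟨true, fun h' => absurd h' h⟩
  choose κ hκ using hex
  refine ⟨fun l => IsReduced (L ++ [l]), κ, ?_, ?_, ?_⟩
  · have key (a : α × Bool) (ha : ¬ IsReduced (L ++ [a])) : L.getLast? = some (linv a) := by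
      rw [isReduced_iff_ne_linv, isChain_append, ← isReduced_iff_ne_linv] at ha
      simp only [hL, isChain_singleton, true_and, head?_cons, Option.mem_some_iff, forall_eq',
        not_forall, not_not] at ha
      obtain ⟨x, hx, rfl⟩ := ha
      exact hx
    intro a b ha hb
    exact linv_injective (Option.some_injective _ ((key a ha).symm.trans (key b hb)))
  · intro k
    by_contra! H
    exact hLk k (evConst_of_forall fun l hl => H l hl ▸ hκ l hl)
  · rintro a b ⟨s, v, hsv⟩ ha hb
    have hPP : IsCyclicallyReduced (P ++ P) := by
      simpa [replicate_succ] using hP.flatten_replicate 2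
    have hq (g : FreeGroup α) : c (g * mk (P ++ P)) = c g := by
      rw [← mul_mk, ← mul_assoc, ← hφ, hci, hci]
    have hw : (mk (P ++ P)).toWord = P ++ P := toWord_mk_of_isReduced hPP.isReduced
    have hinv : (mk (P ++ P))⁻¹.toWord = invRev (P ++ P) := by rw [toWord_inv, hw]
    have hq' (g : FreeGroup α) : c (g * (mk (P ++ P))⁻¹) = c g := by
      rw [← hq (g * _), inv_mul_cancel_right]
    have hPP' : IsCyclicallyReduced (invRev (P ++ P)) := by
      rw [isCyclicallyReduced_iff_append_self] at hPP ⊢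
      rw [← invRev_append, ← toWord_mk_of_isReduced hPP, ← toWord_inv]
      exact isReduced_toWord
    have h1 := eq_of_evConst hq (by rwa [hw]) (s := s ++ [a]) (v := v)
      (by rw [hw, ← hsv]; simp) hb (hκ b hb)
    have h2 := eq_of_evConst hq' (by rwa [hinv]) (s := invRev (b :: v)) (v := invRev s)
      (by rw [hinv, ← hsv]; simp [invRev, linv]) ha (hκ _ ha)
    rw [← h1, ← h2, ← hq]
    congr 1
    rw [← hsv, append_assoc, ← mul_mk, ← mul_mk, ← mul_mk, mk_cons, mk_linv, ← inv_mk,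
      mk_cons a [b], ← mul_mk, mk_cons b v]
    group

end Coloring

section Collapse

variable {α : Type*} [DecidableEq α]

/-- Replaces every `v x` by `x` and every `x⁻¹ v⁻¹` by `x⁻¹` in a word in which `x` only occurs
after `v` and `x⁻¹` only occurs before `v⁻¹`. -/
def collapse (x : α × Bool) : List (α × Bool) → List (α × Bool)
  | [] => []
  | [a] => [a]
  | a :: b :: t =>
    if b = x then x :: collapse x t
    else if a = linv x then linv x :: collapse x t
    else a :: collapse x (b :: t)

/-- Adjacency in reduced words in which `x` only occurs after `v` and `x⁻¹` only occurs
before `v⁻¹`. -/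
def Attached (x v a b : α × Bool) : Prop :=
  a ≠ linv b ∧ (b = x → a = v) ∧ (a = linv x → b = linv v)

variable {x v : α × Bool} {L : List (α × Bool)}

lemma length_collapse_le : (collapse x L).length ≤ L.length := by
  fun_induction collapse x L <;> simp_all <;> omega

lemma collapse_ne_nil (h : L ≠ []) : collapse x L ≠ [] := by
  fun_induction collapse x L <;> simp_all

lemma head?_collapse (hL : L.IsChain (Attached x v)) :
    ∀ h ∈ (collapse x L).head?, h ∈ L.head? ∨ (h = x ∧ v ∈ L.head?) := by
  fun_cases collapse x L
  case case3 a t =>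
    rw [isChain_cons_cons] at hL
    have := hL.1.2.1 rfl
    simp_all
  all_goals simp_all

lemma getLast?_collapse (hL : L.IsChain (Attached x v))
    (hlast : ∀ z ∈ L.getLast?, z ≠ linv x ∧ z ≠ linv v) :
    ∀ z ∈ (collapse x L).getLast?, z ≠ linv x := by
  fun_induction collapse x L
  case case1 => simp
  case case2 => simp_all
  case case3 a t ih =>
    cases t with
    | nil => simpa [collapse] using (linv_ne x).symm
    | cons c t =>
      have h := collapse_ne_nil (x := x) (cons_ne_nil c t)
      rw [getLast?_cons_of_ne_nil h]
      exact ih hL.tail.tail (by simpa using hlast)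
  case case4 b t hb ih =>
    rw [isChain_cons_cons] at hL
    have hbv := hL.1.2.2 rfl
    cases t with
    | nil => simp_all
    | cons c t =>
      have h := collapse_ne_nil (x := x) (cons_ne_nil c t)
      rw [getLast?_cons_of_ne_nil h]
      exact ih hL.2.tail (by simpa using hlast)
  case case5 a b t hb ha ih =>
    rw [getLast?_cons_of_ne_nil (collapse_ne_nil (cons_ne_nil b t))]
    exact ih hL.tail (by simpa using hlast)

lemma isReduced_collapse (hL : L.IsChain (Attached x v)) :
    IsReduced (collapse x L) := by
  rw [isReduced_iff_ne_linv]
  fun_induction collapse x L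
  case case1 => simp
  case case2 => simp
  case case3 a t ih =>
    rw [isChain_cons_cons] at hL
    refine isChain_cons.2 ⟨fun h hh => ?_, ih hL.2.tail⟩
    rcases head?_collapse hL.2.tail h hh with h1 | ⟨rfl, -⟩
    · exact (hL.2.rel_head? h1).1
    · exact (linv_ne _).symm
  case case4 b t hb ih =>
    rw [isChain_cons_cons] at hL
    have hbv := hL.1.2.2 rfl
    refine isChain_cons.2 ⟨fun h hh => linv_injective.ne ?_, ih hL.2.tail⟩
    rcases head?_collapse hL.2.tail h hh with h1 | ⟨-, h1⟩
    · rintro rfl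
      exact linv_ne v (hbv.symm.trans ((hL.2.rel_head? h1).2.1 rfl))
    · exact absurd hbv (hL.2.rel_head? h1).1
  case case5 a b t hb ha ih =>
    rw [isChain_cons_cons] at hL
    refine isChain_cons.2 ⟨fun h hh => ?_, ih hL.2⟩
    rcases head?_collapse hL.2 h hh with h1 | ⟨rfl, -⟩
    · obtain rfl : b = h := by simpa using h1
      exact hL.1.1
    · exact ha

lemma map_mk_eq_mk_collapse {i : α} (hvi : v.1 ≠ i) {ψ : FreeGroup α ≃* FreeGroup α}
    (hψi : ψ (of i) = mk [linv v] * of i) (hψ : ∀ j, j ≠ i → ψ (of j) = of j)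
    (hL : L.IsChain (Attached (i, true) v)) (hhead : ∀ a ∈ L.head?, a ≠ (i, true))
    (hlast : ∀ a ∈ L.getLast?, a ≠ (i, false)) :
    ψ (mk L) = mk (collapse (i, true) L) := by
  have hone {a : α × Bool} (h1 : a ≠ (i, true)) (h2 : a ≠ (i, false)) : ψ (mk [a]) = mk [a] := by
    refine map_mk_of_forall_ne (f := ψ.toMonoidHom) (i := i) hψ ?_
    obtain ⟨j, b⟩ := a
    cases b <;> simp_all
  have hv : ψ (mk [v]) = mk [v] :=
    hone (fun h => hvi (congrArg Prod.fst h)) (fun h => hvi (congrArg Prod.fst h))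
  have hxv : (i, true) ≠ v := fun h => hvi (h ▸ rfl)
  induction hn : L.length using Nat.strong_induction_on generalizing L with
  | _ n ih =>
  subst hn
  have htail {c : α × Bool} {s t : List (α × Bool)} (hs : L = c :: s ++ t) :
      ∀ a ∈ t.getLast?, a ≠ (i, false) := by
    intro a ha
    refine hlast a ?_
    rw [hs, getLast?_append, ha]
    rfl
  match L with
  | [] => simp [collapse, ← one_eq_mk]
  | [a] => simpa [collapse] using hone (hhead a rfl) (hlast a rfl)
  | a :: b :: t =>
    rw [isChain_cons_cons] at hL
    rw [mk_cons, mk_cons b, map_mul, map_mul, collapse]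
    split_ifs with hb ha
    · obtain rfl := hL.1.2.1 hb
      rw [ih t.length (by simp) (L := t) hL.2.tail ?_ (htail (s := [b]) rfl) rfl, hv, hb, mk_true,
        hψi, mk_linv, mk_cons (i, true), mk_true]
      · group
      · rintro c hc rfl
        exact hxv (hb ▸ (hL.2.rel_head? hc).2.1 rfl)
    · obtain rfl := hL.1.2.2 ha
      rw [ih t.length (by simp) (L := t) hL.2.tail ?_ (htail (s := [linv v]) rfl) rfl, mk_linv v,
        map_inv, hv, ha, mk_linv, map_inv, mk_true, hψi, mk_linv,
        mk_cons (linv (i, true)), mk_linv, mk_true]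
      · group
      · rintro c hc rfl
        exact linv_ne v ((hL.2.rel_head? hc).2.1 rfl)
    · have h := ih (b :: t).length (by simp) hL.2 (by simpa using hb) (htail (s := []) rfl) rfl
      rw [mk_cons, map_mul] at h
      rw [h, hone (hhead a rfl) ha, ← mk_cons]

lemma exists_shorter {i : α} (hvi : v.1 ≠ i) {Y V : List (α × Bool)} (hY : ∀ l ∈ Y, l.1 ≠ i)
    (hW : IsReduced ((i, true) :: Y ++ [(i, false)]))
    (hV : (linv v :: V ++ [v]).IsChain (Attached (i, true) v)) :
    ∃ (ψ : FreeGroup α ≃* FreeGroup α) (V' : List (α × Bool)), V'.length ≤ V.length ∧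
      IsCyclicallyReduced ((i, true) :: Y ++ [(i, false)] ++ V') ∧
      ψ (mk ((i, true) :: Y ++ [(i, false)] ++ (linv v :: V ++ [v]))) =
        (mk [v])⁻¹ * mk ((i, true) :: Y ++ [(i, false)] ++ V') * mk [v] := by
  obtain ⟨ψ, hψi, hψ⟩ := exists_mulEquiv_of_forall_ne (i := i) (A := [linv v]) (B := [])
    (by simpa using hvi) (by simp)
  rw [← one_eq_mk, mul_one] at hψi
  have hV1 : V.IsChain (Attached (i, true) v) := hV.infix ⟨[linv v], [v], by simp⟩
  have hhead : ∀ a ∈ V.head?, a ≠ v ∧ a ≠ (i, true) := by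
    intro a ha
    have h : Attached (i, true) v (linv v) a := by
      rw [cons_append] at hV
      exact hV.rel_head? (by rw [head?_append, ha]; rfl)
    exact ⟨fun h' => h.1 (h' ▸ rfl), fun h' => linv_ne v (h.2.1 h')⟩
  have hlast : ∀ a ∈ V.getLast?, a ≠ (i, false) ∧ a ≠ linv v := by
    intro a ha
    rw [cons_append, isChain_cons, isChain_append] at hV
    have h : Attached (i, true) v a v := hV.2.2.2 a ha v rfl
    exact ⟨fun h' => linv_ne v (h.2.2 h').symm, h.1⟩
  have hne : V ≠ [] := by
    rintro rfl
    exact (isChain_pair.1 hV).1 rfl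
  have hne' := collapse_ne_nil (x := (i, true)) hne
  refine ⟨ψ, collapse (i, true) V, length_collapse_le, ?_, ?_⟩
  · rw [isCyclicallyReduced_iff, isReduced_iff_ne_linv, isChain_append]
    refine ⟨⟨isReduced_iff_ne_linv.1 hW, isReduced_iff_ne_linv.1 (isReduced_collapse hV1), ?_⟩,
      ?_⟩
    · rw [getLast?_concat]
      rintro _ ⟨⟩ b hb
      refine linv_injective.ne (a₁ := (i, true)) ?_
      rintro rfl
      rcases head?_collapse hV1 _ hb with h | ⟨-, h⟩
      · exact (hhead _ h).2 rfl
      · exact (hhead _ h).1 rfl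
    · rw [getLast?_append_of_ne_nil _ hne']
      rintro a ha _ ⟨⟩
      rw [← ne_linv_iff]
      exact getLast?_collapse hV1 hlast a ha
  · have h1 := map_mk_eq_mk_collapse hvi hψi hψ hV1 (fun a ha => (hhead a ha).2)
      (fun a ha => (hlast a ha).1)
    have h2 : ψ (mk Y) = mk Y := map_mk_of_forall_ne (f := ψ.toMonoidHom) hψ hY
    have h3 : ψ (mk [v]) = mk [v] :=
      map_mk_of_forall_ne (f := ψ.toMonoidHom) hψ (by simpa using hvi)
    have h4 (X : List (α × Bool)) :
        mk ((i, true) :: Y ++ [(i, false)] ++ X) = of i * mk Y * (of i)⁻¹ * mk X := by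
      rw [← mul_mk, ← mul_mk, mk_cons, mk_true, mk_false]
    have h5 : mk (linv v :: V ++ [v]) = (mk [v])⁻¹ * mk V * mk [v] := by
      rw [← mul_mk, mk_cons, mk_linv]
    rw [h4, h4, h5]
    simp only [map_mul, map_inv, hψi, h1, h2, h3, mk_linv]
    group

end Collapse
section Cycle

/-- A coloring of the circuit `(0, *), (1, b), (2, !b), …, (N, *), …, (2, b), (1, !b), (0, *)` which
is constant along all edges between members of `S` is constant on `S`, if at most one vertex is
not in `S`. -/
lemma exists_color_of_cycle {N : ℕ} (hN : 0 < N) {S : ℕ → Bool → Prop} {κ : ℕ → Bool → Bool}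
    (hS0 : S 0 true ↔ S 0 false) (hκ0 : κ 0 true = κ 0 false)
    (honly : ∀ i j b c, i ≤ N → j ≤ N → ¬S i b → ¬S j c → i = j ∧ (i = 0 ∨ b = c))
    (hstep : ∀ j < N, ∀ b, S j b → S (j + 1) (!b) → κ j b = κ (j + 1) (!b))
    (htop : S N true → S N false → κ N true = κ N false) :
    ∃ K, ∀ j ≤ N, ∀ b, S j b → κ j b = K := by
  have up (j : ℕ) (hj : j ≤ N) (h : ∀ i ≤ j, ∀ b, S i b) (b : Bool) : κ j b = κ 0 true := by
    induction j generalizing b with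
    | zero => cases b <;> simp [hκ0]
    | succ j ih =>
      rw [← ih (by omega) (fun i hi => h i (by omega)) (!b)]
      simpa using (hstep j hj (!b) (h j (by omega) _) (h _ le_rfl _)).symm
  have down (j : ℕ) (hj : j ≤ N) (h : ∀ i, j ≤ i → i ≤ N → ∀ b, S i b) (b : Bool) :
      κ j b = κ N true := by
    induction hd : N - j generalizing j b with
    | zero =>
      obtain rfl : j = N := by omega
      cases b
      · exact (htop (h _ le_rfl le_rfl _) (h _ le_rfl le_rfl _)).symm
      · rfl
    | succ d ih =>
      rw [hstep j (by omega) b (h _ le_rfl hj _) (h _ (by omega) (by omega) _)]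
      exact ih (j + 1) (by omega) (fun i hi => h i (by omega)) _ (by omega)
  by_cases hall : ∀ j ≤ N, ∀ b, S j b
  · exact ⟨κ 0 true, fun j hj b _ => up j hj (fun i hi => hall i (by omega)) b⟩
  push Not at hall
  obtain ⟨k, hk, b₀, hb₀⟩ := hall
  have hne (j : ℕ) (hj : j ≤ N) (hjk : j ≠ k) (b : Bool) : S j b := by
    by_contra h
    exact hjk (honly _ _ _ _ hj hk h hb₀).1
  rcases Nat.eq_zero_or_pos k with rfl | hk0
  · refine ⟨κ N true, fun j hj b hb => down j hj (fun i hi hiN => hne i hiN ?_) b⟩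
    rintro rfl
    obtain rfl : j = 0 := by omega
    cases b <;> cases b₀ <;> tauto
  · have hk' : S k (!b₀) := by
      by_contra h
      have := (honly _ _ _ _ hk hk h hb₀).2
      simp [hk0.ne'] at this
    refine ⟨κ k (!b₀), fun j hj b hb => ?_⟩
    rcases lt_trichotomy j k with h | rfl | h
    · obtain ⟨m, rfl⟩ : ∃ m, k = m + 1 := ⟨k - 1, by omega⟩
      rw [up j hj (fun i hi => hne i (by omega) (by omega)),
        ← hstep m (by omega) b₀ (hne m (by omega) (by omega) _) hk',
        up m (by omega) (fun i hi => hne i (by omega) (by omega))]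
    · rcases Bool.eq_or_eq_not b b₀ with rfl | rfl
      · exact absurd hb hb₀
      · rfl
    · rw [down j hj (fun i hi hiN => hne i hiN (by omega)),
        hstep k (by omega) _ hk' (hne _ (by omega) (by omega) _),
        down (k + 1) (by omega) (fun i hi hiN => hne i hiN (by omega))]

end Cycle

section BlockingWord

variable {n : ℕ}

/-- The letter `x_{j+1}` of `F_{n+2}`, for `j < n + 2`. -/
def letter (n j : ℕ) : Fin (n + 2) × Bool := (Fin.ofNat (n + 2) j, true)

lemma ofNat_inj_of_lt {i j : ℕ} (hi : i < n + 2) (hj : j < n + 2)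
    (h : Fin.ofNat (n + 2) i = Fin.ofNat (n + 2) j) : i = j := by
  simpa [Nat.mod_eq_of_lt hi, Nat.mod_eq_of_lt hj] using congrArg Fin.val h

/-- The middle part `x_2 ⋯ x_{r-1} x_r² x_{r-1} ⋯ x_2` of the blocking word, for `r = n + 2`. -/
def middle (n : ℕ) : List (Fin (n + 2) × Bool) :=
  (range (n + 1)).map (fun j => letter n (j + 1)) ++
    (range (n + 1)).reverse.map (fun j => letter n (j + 1))

/-- The word `x_1 x_2 ⋯ x_{r-1} x_r² x_{r-1} ⋯ x_2 x_1⁻¹`, for `r = n + 2`. -/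
def blockWord (n : ℕ) : List (Fin (n + 2) × Bool) := (0, true) :: middle n ++ [(0, false)]

lemma length_blockWord : (blockWord n).length = 2 * (n + 2) := by
  simp [blockWord, middle]
  omega

lemma of_mem_middle {l : Fin (n + 2) × Bool} (hl : l ∈ middle n) : l.1 ≠ 0 ∧ l.2 = true := by
  obtain ⟨j, hj, rfl⟩ : ∃ j < n + 1, letter n (j + 1) = l := by simpa [middle] using hl
  refine ⟨fun h => ?_, rfl⟩
  exact absurd (ofNat_inj_of_lt (i := j + 1) (j := 0) (by omega) (by omega) h) (by omega)

lemma isReduced_blockWord : IsReduced (blockWord n) := by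
  have h : IsReduced ((0, true) :: middle n) := by
    refine Pairwise.isChain (pairwise_of_forall_mem_list fun a ha b hb _ => ?_)
    have key : ∀ l ∈ (0, true) :: middle n, l.2 = true := by
      rintro l (_ | ⟨_, hl⟩)
      · rfl
      · exact (of_mem_middle hl).2
    rw [key a ha, key b hb]
  refine isChain_append.2 ⟨h, isChain_singleton _, ?_⟩
  have hne : middle n ≠ [] := by simp [middle]
  rw [getLast?_cons_of_ne_nil hne]
  rintro a ha _ ⟨⟩ h0
  exact absurd h0 (of_mem_middle (mem_of_getLast? ha)).1

lemma mk_map_true {α ι : Type*} (f : ι → α) (l : List ι) :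
    mk (l.map fun j => (f j, true)) = (l.map fun j => of (f j)).prod := by
  induction l with
  | nil => rfl
  | cons j l ih => rw [map_cons, mk_cons, ih, map_cons, prod_cons, mk_true]

lemma mk_blockWord : mk (blockWord n) = w8 (n + 2) := by
  have hgen (j : ℕ) (hj : j < n + 2) : gen (n + 2) j = of (Fin.ofNat (n + 2) j) := by
    rw [gen, dif_pos hj]
    congr 1
    ext
    simp [Nat.mod_eq_of_lt hj]
  have h0 : gen (n + 2) 0 = of 0 := hgen 0 (by omega)
  have h1 : (range (n + 1)).map (fun j => gen (n + 2) (j + 1)) =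
      (range (n + 1)).map (fun j => of (Fin.ofNat (n + 2) (j + 1))) :=
    map_congr_left fun j hj => hgen _ (by simpa using hj)
  have h2 : (range (n + 1)).reverse.map (fun j => gen (n + 2) (j + 1)) =
      (range (n + 1)).reverse.map (fun j => of (Fin.ofNat (n + 2) (j + 1))) :=
    map_congr_left fun j hj => hgen _ (by simpa using hj)
  rw [w8, range_succ_eq_map, map_cons, map_map, prod_cons, blockWord, middle, cons_append, mk_cons,
    ← mul_mk, ← mul_mk, mk_true, mk_false]
  simp only [Function.comp_def, Nat.succ_eq_add_one]
  rw [show n + 2 - 1 = n + 1 from rfl, h1, h2, h0, ← mk_map_true, ← mk_map_true]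
  simp only [mul_assoc]
  rfl

lemma toWord_w8 : (w8 (n + 2)).toWord = blockWord n := by
  rw [← mk_blockWord, toWord_mk_of_isReduced isReduced_blockWord]

lemma rel_of_isChain_blockWord {R : Fin (n + 2) × Bool → Fin (n + 2) × Bool → Prop}
    (h : (blockWord n).IsChain R) :
    (∀ j < n + 1, R (letter n j) (letter n (j + 1))) ∧
    R (letter n (n + 1)) (letter n (n + 1)) ∧
    (∀ j < n, R (letter n (j + 2)) (letter n (j + 1))) ∧ R (letter n 1) (0, false) := by
  have hW : blockWord n = (range (n + 2)).map (letter n) ++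
      (range (n + 1)).reverse.map (fun j => letter n (j + 1)) ++ [(0, false)] := by
    rw [range_succ_eq_map (n := n + 1), map_cons, map_map]
    simp [blockWord, middle, letter, Function.comp_def]
  rw [hW, isChain_append, isChain_append, isChain_map, isChain_map, isChain_reverse,
    isChain_range_succ, isChain_range_succ] at h
  obtain ⟨⟨h1, h2, h3⟩, -, h4⟩ := h
  refine ⟨h1, h3 _ ?_ _ ?_, h2, h4 _ ?_ _ rfl⟩
  · simp [range_succ]
  · simp [range_succ]
  · rw [getLast?_append_of_ne_nil _ (by simp), map_reverse, getLast?_reverse]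
    simp [range_succ_eq_map]

/-- A coloring of the letters compatible with the blocking word is constant on the
colored letters other than `x_1`. -/
lemma exists_color_blockWord {S : Fin (n + 2) × Bool → Prop} {κ : Fin (n + 2) × Bool → Bool}
    (honly : ∀ a b, ¬S a → ¬S b → a = b)
    (hW : (blockWord n).IsChain fun a b => S (linv a) → S b → κ (linv a) = κ b) :
    ∃ K, ∀ a, a ≠ (0, true) → S a → κ a = K := by
  obtain ⟨h1, h2, h3, h4⟩ := rel_of_isChain_blockWord hW
  let c (j : ℕ) (b : Bool) : Fin (n + 2) × Bool :=
    if j = 0 then (0, false) else (Fin.ofNat (n + 2) j, b)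
  obtain ⟨K, hK⟩ : ∃ K, ∀ j ≤ n + 1, ∀ b, S (c j b) → κ (c j b) = K := by
    refine exists_color_of_cycle (N := n + 1) (S := fun j b => S (c j b))
      (κ := fun j b => κ (c j b)) (by omega) Iff.rfl rfl ?_ ?_ ?_
    · intro i j b d hi hj hb hd
      have h := honly _ _ hb hd
      by_cases hi0 : i = 0 <;> by_cases hj0 : j = 0
      · exact ⟨hi0.trans hj0.symm, .inl hi0⟩
      · simp only [c, hi0, hj0, if_true, if_false] at h
        exact absurd (ofNat_inj_of_lt (i := 0) (by omega) (by omega) (congrArg Prod.fst h)).symm hj0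
      · simp only [c, hi0, hj0, if_true, if_false] at h
        exact absurd (ofNat_inj_of_lt (j := 0) (by omega) (by omega) (congrArg Prod.fst h)) hi0
      · simp only [c, hi0, hj0, if_false] at h
        exact ⟨ofNat_inj_of_lt (by omega) (by omega) (congrArg Prod.fst h),
          .inr (congrArg Prod.snd h)⟩
    · intro j hj b hS hS'
      rcases Nat.eq_zero_or_pos j with rfl | hj0
      · cases b
        · exact h1 0 hj hS hS'
        · exact (h4 hS' hS).symm
      · obtain ⟨m, rfl⟩ : ∃ m, j = m + 1 := ⟨j - 1, by omega⟩
        cases b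
        · exact h1 (m + 1) hj hS hS'
        · exact (h3 m (by omega) hS' hS).symm
    · exact fun hS hS' => (h2 hS' hS).symm
  refine ⟨K, fun ⟨j, b⟩ hj hS => ?_⟩
  have hc : (j, b) = c j b := by
    by_cases h : (j : ℕ) = 0
    · obtain rfl : j = 0 := Fin.ext h
      cases b
      · rfl
      · exact absurd rfl hj
    · simp [c, h]
  rw [hc] at hS ⊢
  exact hK j (Nat.le_of_lt_succ j.2) b hS

end BlockingWord
section Descent

variable {n : ℕ} {hn : 0 < n + 2} {V : List (Fin (n + 2) × Bool)}

lemma exists_attached (hV : IsCyclicallyReduced (blockWord n ++ V))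
    (hp : Primitive hn (mk (blockWord n ++ V))) :
    ∃ (v : Fin (n + 2) × Bool) (V' : List (Fin (n + 2) × Bool)), v.1 ≠ 0 ∧
      V = linv v :: V' ++ [v] ∧ V.IsChain (Attached (0, true) v) := by
  obtain ⟨φ, hφ⟩ := hp
  have hij : (⟨0, hn⟩ : Fin (n + 2)) ≠ ⟨1, by omega⟩ := by simp
  obtain ⟨S, κ, honly, hk, hR⟩ := exists_whitehead_coloring φ hij hV hφ
  have hPP := isReduced_iff_ne_linv.1 (isCyclicallyReduced_iff_append_self.1 hV)
  have hchain := isChain_isInfix (blockWord n ++ V ++ (blockWord n ++ V))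
  generalize hP : blockWord n ++ V ++ (blockWord n ++ V) = P at hR hPP hchain
  have hne {a b : Fin (n + 2) × Bool} (h : [a, b] <:+: P) : a ≠ linv b :=
    (isChain_pair (R := fun a b => a ≠ linv b)).1 (hPP.infix h)
  have hW : (blockWord n).IsChain fun a b => [a, b] <:+: P :=
    hchain.infix ⟨[], V ++ (blockWord n ++ V), by simp [← hP]⟩
  obtain ⟨K, hK⟩ := exists_color_blockWord honly (hW.imp hR)
  let x : Fin (n + 2) × Bool := (0, true)
  -- `N a`: `a` is joined to `x` in the Whitehead graph
  let N (a : Fin (n + 2) × Bool) : Prop := [linv a, x] <:+: P ∨ [linv x, a] <:+: P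
  have hNx {a : Fin (n + 2) × Bool} (ha : N a) : a ≠ x := by
    rintro rfl
    rcases ha with ha | ha
    · exact hne ha rfl
    · exact hne ha rfl
  have hNS {a : Fin (n + 2) × Bool} (ha : N a) : ¬S a := by
    intro haS
    have hx : S x → κ x = K := by
      intro hx
      rw [← hK a (hNx ha) haS]
      rcases ha with ha | ha
      · simpa using (hR _ _ ha (by simpa) hx).symm
      · simpa using hR _ _ ha (by simpa) haS
    obtain ⟨l, hl, hlK⟩ := hk K
    by_cases hlx : l = x
    · exact hlK (by rw [hlx] at hl ⊢; exact hx hl)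
    · exact hlK (hK l hlx hl)
  have hNN {a b : Fin (n + 2) × Bool} (ha : N a) (hb : N b) : a = b := honly _ _ (hNS ha) (hNS hb)
  have hVne : V ≠ [] := by
    rintro rfl
    rw [append_nil, isCyclicallyReduced_iff] at hV
    exact Bool.false_ne_true (hV.2 (0, false) (by rw [blockWord, getLast?_concat]; rfl)
      (0, true) rfl rfl)
  obtain ⟨V₀, v, rfl⟩ := (eq_nil_or_concat' V).resolve_left hVne
  have hv : N (linv v) := by
    refine .inl ⟨blockWord n ++ V₀, middle n ++ [(0, false)] ++ (V₀ ++ [v]), ?_⟩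
    simp [← hP, blockWord, x]
  have hchainA : P.IsChain (Attached x v) := by
    refine hchain.imp fun a b hab => ⟨hne hab, ?_, ?_⟩
    · rintro rfl
      have h : N (linv a) := .inl (by simpa using hab)
      exact linv_injective (hNN h hv)
    · rintro rfl
      exact hNN (.inr hab) hv
  have hVchain : (linv x :: (V₀ ++ [v])).IsChain (Attached x v) :=
    hchainA.infix ⟨(0, true) :: middle n, blockWord n ++ (V₀ ++ [v]),
      by simp [← hP, blockWord, x, linv]⟩
  have hvx' : v ≠ linv x := fun h => hNx hv (by simp [h])
  have hvx : v ≠ x := by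
    intro h
    have hall : ∀ (L : List (Fin (n + 2) × Bool)), (linv x :: L).IsChain (Attached x v) →
        ∀ a ∈ L, a = linv x := by
      intro L hL
      induction L with
      | nil => simp
      | cons b L ih =>
        rw [isChain_cons_cons] at hL
        obtain rfl : b = linv x := h ▸ hL.1.2.2 rfl
        simpa using ih hL.2
    exact hvx' (hall _ hVchain v (by simp))
  cases V₀ with
  | nil => exact absurd ((isChain_pair.1 hVchain).2.2 rfl).symm (linv_ne v)
  | cons b V' =>
    rw [cons_append, isChain_cons_cons] at hVchain
    obtain rfl := hVchain.1.2.2 rfl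
    refine ⟨v, V', fun h => ?_, rfl, hVchain.2⟩
    obtain ⟨j, b⟩ := v
    obtain rfl : j = 0 := h
    cases b
    · exact hvx' rfl
    · exact hvx rfl

lemma not_primitive_mk_blockWord_append (hV : IsCyclicallyReduced (blockWord n ++ V)) :
    ¬Primitive hn (mk (blockWord n ++ V)) := by
  induction hm : V.length using Nat.strong_induction_on generalizing V with
  | _ m ih =>
  subst hm
  intro hp
  obtain ⟨v, V', hv, rfl, hchain⟩ := exists_attached hV hp
  obtain ⟨ψ, V'', hlen, hred, hψ⟩ := exists_shorter hv (fun l hl => (of_mem_middle hl).1)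
    isReduced_blockWord hchain
  refine ih V''.length (by simp; omega) hred rfl ?_
  have h := (hp.map ψ).conj (mk [v])
  rw [blockWord, hψ] at h
  rwa [mul_assoc (mk [v])⁻¹, mul_inv_cancel_left, mul_inv_cancel_right] at h

lemma primitivityBlocking_w8 : PrimitivityBlocking hn (w8 (n + 2)) := by
  intro p hp hred hW
  rw [toWord_w8] at hW
  rw [cyclicallyReduced_iff] at hred
  obtain ⟨s, t, hst⟩ := hW
  have h3 : IsReduced (p.toWord ++ p.toWord ++ p.toWord) := by
    simpa [replicate] using (hred.flatten_replicate 3).isReduced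
  refine not_primitive_mk_blockWord_append (hn := hn) (V := t ++ s) ?_ ?_
  · refine isCyclicallyReduced_iff_append_self.2 (h3.infix ⟨s, blockWord n ++ t, ?_⟩)
    simp [← hst]
  · have h := hp.conj (mk s)⁻¹
    rw [← mk_toWord (x := p), ← hst, ← mul_mk, ← mul_mk, inv_inv, mul_assoc, mul_assoc, mul_assoc,
      inv_mul_cancel_left] at h
    rwa [← mul_mk, ← mul_mk]

end Descent

end PrimitiveWord

/-- For `r > 2`, the word
`w = x_1 x_2 x_3 ⋯ x_{r-1} x_r² x_{r-1} ⋯ x_3 x_2 x_1⁻¹` (of length `2r`) is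
primitivity-blocking, and it is shortest: no element of reduced length less than `2r`
is primitivity-blocking. -/
theorem shortest_pb_in_Fr {r : ℕ} (hr : 2 < r) :
    wordLength (w8 r) = 2 * r ∧
    PrimitivityBlocking (by omega) (w8 r) ∧
    ∀ u : FG r, wordLength u < 2 * r → ¬ PrimitivityBlocking (by omega) u := by
  refine ⟨?_, ?_, fun u hu => PrimitiveWord.not_primitivityBlocking_of_length_lt hr hu⟩
  all_goals obtain ⟨n, rfl⟩ : ∃ n, r = n + 2 := ⟨r - 2, by omega⟩
  · rw [wordLength, PrimitiveWord.toWord_w8, PrimitiveWord.length_blockWord]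
  · exact PrimitiveWord.primitivityBlocking_w8
end

section
/- For every r ≥ 2, the word w = x_1 x_2 ⋯ x_{r−1} x_r² x_{r−1} ⋯ x_2 x_1 ∈ F_r is not primitivity-blocking; that is, there exists a cyclically reduced primitive element p of F_r whose reduced word contains the reduced word of w as a contiguous subword (infix). -/
/-- The word `x_1 x_2 ⋯ x_{r-1} x_r² x_{r-1} ⋯ x_2 x_1` of `F_r`. -/
def w9 (r : ℕ) : FG r :=
  ((List.range r).map (gen r)).prod * ((List.range r).reverse.map (gen r)).prod

theorem prod_map_of_eq_mk {α : Type*} (l : List α) :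
    (l.map FreeGroup.of).prod = FreeGroup.mk (l.map fun a => (a, true)) := by
  induction l with
  | nil => rfl
  | cons a l ih => simp [ih, FreeGroup.of]

/-- A product of generators is already reduced. -/
theorem toWord_prod_map_of {α : Type*} [DecidableEq α] (l : List α) :
    (l.map FreeGroup.of).prod.toWord = l.map fun a => (a, true) := by
  rw [prod_map_of_eq_mk, FreeGroup.toWord_mk, ← FreeGroup.isReduced_iff_reduce_eq]
  induction l with
  | nil => simp
  | cons a l ih => cases l <;> simp_all [FreeGroup.isReduced_cons_cons]

theorem cyclicallyReduced_prod_map_of {r : ℕ} (l : List (Fin r)) :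
    CyclicallyReduced (l.map FreeGroup.of).prod := by
  intro a ha b hb hab
  rw [toWord_prod_map_of] at ha hb
  obtain ⟨i, -, rfl⟩ := List.mem_map.1 (List.mem_of_mem_head? ha)
  obtain ⟨j, -, rfl⟩ := List.mem_map.1 (List.mem_of_mem_getLast? hb)
  simp at hab

theorem w9_eq_prod_map_of (r : ℕ) :
    w9 r = ((List.finRange r ++ (List.finRange r).reverse).map FreeGroup.of).prod := by
  have h : (List.range r).map (gen r) = (List.finRange r).map FreeGroup.of := by
    rw [← List.map_coe_finRange_eq_range, List.map_map]
    exact List.map_congr_left fun i _ => by simp [gen]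
  simp [w9, List.map_reverse, h]

/-- If `m` avoids `x_1` and `x_2`, then `x_1 x_2 m x_2 x_1 x_2` is primitive: in the basis
`x_1 x_2, x_2, …, x_r` the letter `x_2` occurs in it exactly once. -/
theorem primitive_of_mem_closure {n : ℕ} (m : FG (n + 2))
    (hm : m ∈ Subgroup.closure (Set.range fun i : Fin n => FreeGroup.of i.succ.succ)) :
    Primitive (Nat.succ_pos _)
      (FreeGroup.of 0 * FreeGroup.of 1 * m * FreeGroup.of 1 * FreeGroup.of 0 *
        FreeGroup.of 1) := by
  let a : FG (n + 2) := FreeGroup.of 0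
  let b : FG (n + 2) := FreeGroup.of 1
  let c : Fin n → FG (n + 2) := fun i => FreeGroup.of i.succ.succ
  let f : FG (n + 2) →* FG (n + 2) :=
    FreeGroup.lift (Fin.cons (a * b * m * b * a * b) (Fin.cons (a * b) c))
  let g : FG (n + 2) →* FG (n + 2) :=
    FreeGroup.lift (Fin.cons (b * b * a⁻¹ * b * m) (Fin.cons (m⁻¹ * b⁻¹ * a * b⁻¹) c))
  have fa : f a = a * b * m * b * a * b := by simp [f, a]
  have fb : f b = a * b := by
    simp only [f, b, FreeGroup.lift_apply_of]; rfl
  have fc (i) : f (c i) = c i := by simp [f, c]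
  have ga : g a = b * b * a⁻¹ * b * m := by simp [g, a]
  have gb : g b = m⁻¹ * b⁻¹ * a * b⁻¹ := by
    simp only [g, b, FreeGroup.lift_apply_of]; rfl
  have gc (i) : g (c i) = c i := by simp [g, c]
  have fixes_m (φ : FG (n + 2) →* FG (n + 2)) (h : ∀ i, φ (c i) = c i) : φ m = m := by
    have : Set.EqOn φ (MonoidHom.id _) (Set.range c) := by
      rintro _ ⟨i, rfl⟩
      exact h i
    exact MonoidHom.eqOn_closure this hm
  have fm := fixes_m f fc
  have gm := fixes_m g gc
  have ext_gens (φ : FG (n + 2) →* FG (n + 2)) (h0 : φ a = a) (h1 : φ b = b)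
      (h2 : ∀ i, φ (c i) = c i) : φ = MonoidHom.id _ := by
    refine FreeGroup.ext_hom _ _ fun i => ?_
    refine Fin.cases h0 (fun i => ?_) i
    exact Fin.cases h1 h2 i
  have gf : g.comp f = MonoidHom.id _ := by
    apply ext_gens
    · simp [fa, ga, gb, gm, mul_assoc]
    · simp [fb, ga, gb, mul_assoc]
    · simp [fc, gc]
  have fg : f.comp g = MonoidHom.id _ := by
    apply ext_gens
    · simp [ga, fa, fb, fm, mul_assoc]
    · simp [gb, fa, fb, fm, mul_assoc]
    · simp [fc, gc]
  exact ⟨MonoidHom.toMulEquiv f g gf fg, fa⟩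

/-- For every `r ≥ 2`, the word
`w = x_1 x_2 ⋯ x_{r-1} x_r² x_{r-1} ⋯ x_2 x_1` is not primitivity-blocking: some
cyclically reduced primitive element of `F_r` contains its reduced word as an infix. -/
theorem not_pb_w9 {r : ℕ} (hr : 2 ≤ r) :
    ∃ p : FG r, Primitive (by omega) p ∧ CyclicallyReduced p ∧
      (w9 r).toWord <:+: p.toWord := by
  obtain ⟨n, rfl⟩ := Nat.exists_eq_add_of_le' hr
  let l := List.finRange (n + 2) ++ (List.finRange (n + 2)).reverse
  refine ⟨((l ++ [1]).map FreeGroup.of).prod, ?_, cyclicallyReduced_prod_map_of _, ?_⟩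
  · let t : List (Fin (n + 2)) := (List.finRange n).map fun i => i.succ.succ
    have hm : ((t ++ t.reverse).map FreeGroup.of).prod ∈
        Subgroup.closure (Set.range fun i : Fin n => FreeGroup.of i.succ.succ) := by
      refine Subgroup.list_prod_mem _ fun x hx => Subgroup.subset_closure ?_
      simp only [t, List.mem_map, List.mem_append, List.mem_reverse, or_self] at hx
      obtain ⟨_, ⟨i, -, rfl⟩, rfl⟩ := hx
      exact ⟨i, rfl⟩
    have hl : l ++ [1] = [0, 1] ++ (t ++ t.reverse) ++ [1, 0, 1] := by
      simp [l, t, List.finRange_succ, Function.comp_def]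
    convert primitive_of_mem_closure _ hm using 1
    simp only [hl, List.map_append, List.prod_append]
    simp [mul_assoc]
  · rw [w9_eq_prod_map_of, toWord_prod_map_of, toWord_prod_map_of, List.map_append (l₂ := [1])]
    exact (List.prefix_append _ _).isInfix
end

section
/- Let r ≥ 3 and set u = x_2 x_3 ⋯ x_{r−1} x_r² x_{r−1} ⋯ x_3 x_2 ∈ F_r. Then the element v = u x_1 u x_1 x_3 is a cyclically reduced primitive element of F_r. -/
/-- The word `u = x_2 x_3 ⋯ x_{r-1} x_r² x_{r-1} ⋯ x_3 x_2` of `F_r`. -/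
def u10 (r : ℕ) : FG r :=
  ((List.range (r - 1)).map (fun j => gen r (j + 1))).prod *
    ((List.range (r - 1)).reverse.map (fun j => gen r (j + 1))).prod

namespace Positive

variable {r : ℕ}

theorem one : Positive (1 : FG r) := by
  simp [Positive]

theorem mul {a b : FG r} (ha : Positive a) (hb : Positive b) : Positive (a * b) := by
  intro l hl
  rcases List.mem_append.1 ((FreeGroup.toWord_mul_sublist a b).subset hl) with h | h
  exacts [ha l h, hb l h]

theorem list_prod {L : List (FG r)} (h : ∀ a ∈ L, Positive a) : Positive L.prod :=
  List.prod_induction Positive (fun _ _ => mul) one h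

theorem gen (j : ℕ) : Positive (gen r j) := by
  unfold _root_.gen
  split_ifs
  · simp [Positive]
  · exact one

theorem u10 : Positive (u10 r) :=
  (list_prod (by simp [gen])).mul (list_prod (by simp [gen]))

theorem cyclicallyReduced {a : FG r} (ha : Positive a) : CyclicallyReduced a := by
  intro x hx y hy hxy
  have h₁ := ha x (List.mem_of_mem_head? hx)
  have h₂ := ha y (List.mem_of_mem_getLast? hy)
  simp [hxy, h₂] at h₁

end Positive

/-- The endomorphism of a free group sending the generator `i` to `g * i` and fixing the
other generators. -/
def leftTransvection {α : Type*} [DecidableEq α] (i : α) (g : FreeGroup α) :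
    FreeGroup α →* FreeGroup α :=
  FreeGroup.lift (Function.update FreeGroup.of i (g * FreeGroup.of i))

section leftTransvection

variable {α : Type*} [DecidableEq α] {i : α} {g : FreeGroup α}

theorem leftTransvection_of_self :
    leftTransvection i g (FreeGroup.of i) = g * FreeGroup.of i := by
  simp [leftTransvection]

theorem leftTransvection_of_ne {j : α} (h : j ≠ i) :
    leftTransvection i g (FreeGroup.of j) = FreeGroup.of j := by
  simp [leftTransvection, h]

theorem leftTransvection_comp_of_mul_eq_one {g' : FreeGroup α}
    (hg : leftTransvection i g g' = g') (h : g' * g = 1) :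
    (leftTransvection i g).comp (leftTransvection i g') = MonoidHom.id _ := by
  ext j
  by_cases hj : j = i
  · subst hj
    simp [leftTransvection_of_self, hg, ← mul_assoc, h]
  · simp [leftTransvection_of_ne hj]

/-- When `g` does not involve the generator `i`, the left transvection by `g` at `i` is an
automorphism. -/
def leftTransvectionEquiv (i : α) (g : FreeGroup α) (h : ∀ a, leftTransvection i a g = g) :
    FreeGroup α ≃* FreeGroup α :=
  (leftTransvection i g).toMulEquiv (leftTransvection i g⁻¹)
    (leftTransvection_comp_of_mul_eq_one (h _) (mul_inv_cancel g))
    (leftTransvection_comp_of_mul_eq_one (by rw [map_inv, h]) (inv_mul_cancel g))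

theorem leftTransvectionEquiv_apply (h : ∀ a, leftTransvection i a g = g) (x : FreeGroup α) :
    leftTransvectionEquiv i g h x = leftTransvection i g x :=
  rfl

end leftTransvection

theorem leftTransvection_gen_succ {r : ℕ} (hr : 0 < r) (a : FG r) (j : ℕ) :
    leftTransvection ⟨0, hr⟩ a (gen r (j + 1)) = gen r (j + 1) := by
  unfold gen
  split_ifs
  · exact leftTransvection_of_ne (by simp)
  · exact map_one _

theorem leftTransvection_u10 {r : ℕ} (hr : 0 < r) (a : FG r) :
    leftTransvection ⟨0, hr⟩ a (u10 r) = u10 r := by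
  simp [u10, map_list_prod, Function.comp_def, leftTransvection_gen_succ]

/-- For `r ≥ 3`, with `u = x_2 x_3 ⋯ x_{r-1} x_r² x_{r-1} ⋯ x_3 x_2`,
the element `v = u x_1 u x_1 x_3` is a cyclically reduced primitive element of `F_r`. -/
theorem v10_cyclically_reduced_primitive {r : ℕ} (hr : 3 ≤ r) :
    CyclicallyReduced (u10 r * gen r 0 * u10 r * gen r 0 * gen r 2) ∧
    Primitive (by omega) (u10 r * gen r 0 * u10 r * gen r 0 * gen r 2) := by
  have hpos {j : ℕ} : Positive (gen r j) := Positive.gen j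
  refine ⟨((((Positive.u10.mul hpos).mul .u10).mul hpos).mul hpos).cyclicallyReduced, ?_⟩
  let x : Fin r := ⟨0, by omega⟩
  let z : Fin r := ⟨2, by omega⟩
  have hxz : x ≠ z := by simp [x, z]
  have hsq (a : FG r) :
      leftTransvection z a (FreeGroup.of x * FreeGroup.of x) = FreeGroup.of x * FreeGroup.of x := by
    rw [map_mul, leftTransvection_of_ne hxz]
  refine ⟨(FreeGroup.freeGroupCongr (Equiv.swap x z)).trans
    ((leftTransvectionEquiv z _ hsq).trans
      (leftTransvectionEquiv x (u10 r) (leftTransvection_u10 _))), ?_⟩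
  have hx : gen r 0 = FreeGroup.of x := dif_pos _
  have hz : gen r 2 = FreeGroup.of z := dif_pos _
  change leftTransvection x (u10 r) (leftTransvection z (FreeGroup.of x * FreeGroup.of x)
    (FreeGroup.freeGroupCongr (Equiv.swap x z) (FreeGroup.of x))) = _
  simp [hx, hz, leftTransvection_of_self, leftTransvection_of_ne hxz.symm, mul_assoc]
end

section
/- In the free group F_r (r ≥ 2), for every integer n ≥ 2, the word x_1^n x_2^n ⋯ x_r^n x_1 is primitivity-blocking. -/
namespace FreeGroup

variable {α : Type*}

theorem isReduced_append_singleton_of_ne {L : List (α × Bool)} (hL : IsReduced L) {l : α × Bool}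
    (h : ∀ c ∈ L.getLast?, c ≠ (l.1, !l.2)) : IsReduced (L ++ [l]) := by
  refine List.isChain_append.2 ⟨hL, List.isChain_singleton _, ?_⟩
  intro c hc d hd hcd
  simp only [List.head?_cons, Option.mem_def, Option.some.injEq] at hd
  subst hd
  by_contra hne
  exact h c hc (Prod.ext hcd (by simpa [← Bool.eq_not] using hne))

theorem IsCyclicallyReduced.invRev {L : List (α × Bool)} (h : IsCyclicallyReduced L) :
    IsCyclicallyReduced (invRev L) := by
  classical
  refine ⟨?_, ?_⟩
  · rw [isReduced_iff_reduce_eq, reduce_invRev, h.1.reduce_eq]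
  · intro a ha b hb hab
    simp only [FreeGroup.invRev, List.getLast?_reverse, List.head?_reverse, List.head?_map,
      List.getLast?_map, Option.mem_def, Option.map_eq_some_iff] at ha hb
    obtain ⟨a, ha, rfl⟩ := ha
    obtain ⟨b, hb, rfl⟩ := hb
    simpa using (h.2 b hb a ha hab.symm).symm

variable [DecidableEq α]

/-- Multiplying by a letter either appends it to the reduced word or deletes the last letter. -/
theorem toWord_mul_letter (y : FreeGroup α) (l : α × Bool) :
    (y * mk [l]).toWord = y.toWord ++ [l] ∨
      y.toWord = (y * mk [l]).toWord ++ [(l.1, !l.2)] := by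
  by_cases h : IsReduced (y.toWord ++ [l])
  · left
    rw [← h.reduce_eq, ← toWord_mk, ← mul_mk, mk_toWord]
  · right
    have : ¬ ∀ c ∈ y.toWord.getLast?, c ≠ (l.1, !l.2) :=
      fun h' => h (isReduced_append_singleton_of_ne isReduced_toWord h')
    push Not at this
    obtain ⟨c, hc, rfl⟩ := this
    obtain ⟨L, hL⟩ := List.getLast?_eq_some_iff.1 hc
    have hred : IsReduced L := (isReduced_toWord (x := y)).infix ⟨[], [(l.1, !l.2)], by simp [hL]⟩
    have : y * mk [l] = mk L := by
      have hy : y = mk L * (mk [l])⁻¹ := by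
        rw [inv_mk, mul_mk, ← mk_toWord (x := y), hL]
        rfl
      rw [hy, inv_mul_cancel_right]
    rw [this, toWord_mk, hred.reduce_eq, hL]

theorem head?_toWord_mul_mk {M : List (α × Bool)} {y : FreeGroup α} (h : M.length < y.norm) :
    (y * mk M).toWord.head? = y.toWord.head? := by
  induction M generalizing y with
  | nil => simp [← one_eq_mk]
  | cons l M ih =>
    have hM : mk (l :: M) = mk [l] * mk M := by rw [mul_mk]; rfl
    rw [List.length_cons] at h
    have hy := toWord_mul_letter y l
    have hlen : M.length < (y * mk [l]).norm := by
      unfold norm at h ⊢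
      rcases hy with hy | hy
      · rw [hy, List.length_append]; omega
      · rw [hy, List.length_append, List.length_singleton] at h; omega
    rw [hM, ← mul_assoc, ih hlen]
    rcases hy with hy | hy
    · rw [hy, List.head?_append_of_ne_nil]
      rintro h0
      simp [norm, h0] at h
    · conv_rhs => rw [hy]
      rw [List.head?_append_of_ne_nil]
      rintro h0
      simp [norm, h0] at hlen

theorem head?_toWord_mul_of_eq_iff {i j : α} (hij : i ≠ j) (y : FreeGroup α) :
    (y * of i).toWord.head? = some (j, true) ↔ y.toWord.head? = some (j, true) := by
  rcases toWord_mul_letter y (i, true) with h | h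
  · change (y * of i).toWord = _ at h
    rw [h]
    cases y.toWord <;> simp [hij]
  · rw [h]
    change _ ↔ ((y * of i).toWord ++ _).head? = _
    cases (y * of i).toWord <;> simp

/-- A ray leaving `h` along the letter `b` and then following the periodic word of `q`. -/
theorem toWord_mul_mk_mul_pow {q h : FreeGroup α} (hq : IsCyclicallyReduced q.toWord)
    {b : α × Bool} {u t : List (α × Bool)} (hw : q.toWord = u ++ b :: t)
    (hb : IsReduced (h.toWord ++ [b])) (k : ℕ) :
    (h * mk (b :: t) * q ^ k).toWord =
      h.toWord ++ [b] ++ (t ++ (List.replicate k q.toWord).flatten) := by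
  have hred : IsReduced ([b] ++ (t ++ (List.replicate k q.toWord).flatten)) := by
    refine (hq.flatten_replicate (k + 1)).isReduced.infix ⟨u, [], ?_⟩
    rw [List.replicate_succ, List.flatten_cons, hw]
    simp
  have := hb.append_overlap hred (by simp)
  rw [← this.reduce_eq, ← toWord_mk]
  congr 1
  have hpow : q ^ k = mk (List.replicate k q.toWord).flatten := by
    rw [← pow_mk, mk_toWord]
  rw [hpow]
  conv_lhs => rw [← mk_toWord (x := h)]
  simp [mul_mk]

theorem le_length_flatten_replicate {β : Type*} {L : List β} (hL : L ≠ []) (k : ℕ) :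
    k ≤ (List.replicate k L).flatten.length := by
  have := List.length_pos_of_ne_nil hL
  simp only [List.length_flatten, List.map_replicate, List.sum_replicate, smul_eq_mul]
  nlinarith

/-- Outside a ball containing its coboundary, a set is constant on extensions of a word. -/
theorem mem_iff_of_isPrefix_toWord {A : Set (FreeGroup α)} {N : ℕ}
    (hN : ∀ g : FreeGroup α, ∀ l, N ≤ g.norm → (g * mk [l] ∈ A ↔ g ∈ A))
    {h g : FreeGroup α} (hh : N ≤ h.norm) (hg : h.toWord <+: g.toWord) : g ∈ A ↔ h ∈ A := by
  obtain ⟨L, hL⟩ := hg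
  have hgm : g = h * mk L := by rw [← mk_toWord (x := g), ← hL, ← mul_mk, mk_toWord]
  have hred : IsReduced (h.toWord ++ L) := hL ▸ isReduced_toWord
  clear hL
  subst hgm
  induction L using List.reverseRecOn with
  | nil => simp [← one_eq_mk]
  | append_singleton L l ih =>
    have hred' : IsReduced (h.toWord ++ L) := hred.infix ⟨[], [l], by simp⟩
    rw [← mul_mk, ← mul_assoc]
    refine (hN _ _ (hh.trans ?_)).trans (ih hred')
    rw [← mk_toWord (x := h), mul_mk, norm, norm, toWord_mk, toWord_mk, hred'.reduce_eq,
      reduce_toWord, List.length_append]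
    omega

/-- The Whitehead graph of the word `L`, with an edge between `a⁻¹` and `b` for each subword `ab`,
stays connected after deleting any one vertex. -/
def WhiteheadBiconnected (L : List (α × Bool)) : Prop :=
  ∀ ok c : α × Bool → Prop, (∀ x y, ¬ ok x → ¬ ok y → x = y) →
    (∀ a b, [a, b] <:+: L → ok (a.1, !a.2) → ok b → (c (a.1, !a.2) ↔ c b)) →
    ∀ x y, ok x → ok y → (c x ↔ c y)

/-- If the Whitehead graph of a cyclically reduced `p` is connected without cut vertices, then every
set with finite coboundary that is invariant under right multiplication by `p` is finite or
cofinite. -/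
theorem mem_iff_mem_of_whiteheadBiconnected {p : FreeGroup α} (hp : IsCyclicallyReduced p.toWord)
    (hW : WhiteheadBiconnected p.toWord) {A : Set (FreeGroup α)} (hA : ∀ g, g * p ∈ A ↔ g ∈ A)
    {N : ℕ} (hN : ∀ g : FreeGroup α, ∀ l, N ≤ g.norm → (g * mk [l] ∈ A ↔ g ∈ A))
    {g g' : FreeGroup α} (hg : N ≤ g.norm) (hg' : N ≤ g'.norm) : g ∈ A ↔ g' ∈ A := by
  have hApow : ∀ (k : ℕ) g, g * p ^ k ∈ A ↔ g ∈ A := by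
    intro k
    induction k with
    | zero => simp
    | succ k ih => intro g; rw [pow_succ, ← mul_assoc, hA, ih]
  suffices key : ∀ j, ∀ h : FreeGroup α, N - j ≤ h.norm → ∀ g g' : FreeGroup α,
      h.toWord <+: g.toWord → h.toWord <+: g'.toWord → N ≤ g.norm → N ≤ g'.norm →
      (g ∈ A ↔ g' ∈ A) from
    key N 1 (by simp) g g' (by simp) (by simp) hg hg'
  clear hg hg' g g'
  intro j
  induction j with
  | zero =>
    intro h hh g g' hg hg' _ _
    rw [mem_iff_of_isPrefix_toWord hN hh hg, mem_iff_of_isPrefix_toWord hN hh hg']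
  | succ j ih =>
    intro h hh g g' hg hg' hgN hgN'
    by_cases hj : N - j ≤ h.norm
    · exact ih h hj g g' hg hg' hgN hgN'
    have hhN : h.norm < N := by omega
    have branch : ∀ l, IsReduced (h.toWord ++ [l]) → ∀ g g' : FreeGroup α,
        h.toWord ++ [l] <+: g.toWord → h.toWord ++ [l] <+: g'.toWord → N ≤ g.norm →
        N ≤ g'.norm → (g ∈ A ↔ g' ∈ A) := by
      intro l hl g g' hg hg'
      have hw : (mk (h.toWord ++ [l])).toWord = h.toWord ++ [l] := by
        rw [toWord_mk, hl.reduce_eq]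
      refine ih (mk (h.toWord ++ [l])) ?_ g g' (hw.symm ▸ hg) (hw.symm ▸ hg')
      rw [norm, hw, List.length_append]
      change _ ≤ h.norm + 1
      omega
    have extend : ∀ g : FreeGroup α, h.toWord <+: g.toWord → N ≤ g.norm →
        ∃ l, IsReduced (h.toWord ++ [l]) ∧ h.toWord ++ [l] <+: g.toWord := by
      rintro g ⟨L, hL⟩ hgN
      cases L with
      | nil =>
        rw [List.append_nil] at hL
        rw [norm, ← hL] at hgN
        exact absurd hhN (not_lt.2 hgN)
      | cons l L =>
        exact ⟨l, isReduced_toWord.infix ⟨[], L, by simpa using hL⟩, L, by simpa using hL⟩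
    obtain ⟨l, hl, hlg⟩ := extend g hg hgN
    obtain ⟨l', hl', hlg'⟩ := extend g' hg' hgN'
    have hc := hW (fun l => IsReduced (h.toWord ++ [l]))
      (fun l => ∀ g : FreeGroup α, h.toWord ++ [l] <+: g.toWord → N ≤ g.norm → g ∈ A)
      ?_ ?_ l l' hl hl'
    · exact ⟨fun hm => hc.1 (fun _ h1 h2 => (branch l hl _ _ h1 hlg h2 hgN).2 hm) g' hlg' hgN',
        fun hm => hc.2 (fun _ h1 h2 => (branch l' hl' _ _ h1 hlg' h2 hgN').2 hm) g hlg hgN⟩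
    · intro x y hx hy
      have aux : ∀ x, ¬ IsReduced (h.toWord ++ [x]) → (x.1, !x.2) ∈ h.toWord.getLast? := by
        intro x hx
        by_contra hne
        exact hx (isReduced_append_singleton_of_ne isReduced_toWord
          fun c hc hcx => hne (hcx ▸ hc))
      have := Option.mem_unique (aux x hx) (aux y hy)
      simpa [Prod.ext_iff] using this
    · rintro a b ⟨u, t, hut⟩ ha hb
      have hw : p.toWord = (u ++ [a]) ++ b :: t := by simp [← hut]
      have hw' : p⁻¹.toWord = (invRev t ++ [(b.1, !b.2)]) ++ (a.1, !a.2) :: invRev u := by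
        simp [toWord_inv, ← hut, invRev]
      have hq : IsCyclicallyReduced p⁻¹.toWord := toWord_inv p ▸ hp.invRev
      have h1 := toWord_mul_mk_mul_pow hp hw hb N
      have h2 := toWord_mul_mk_mul_pow hq hw' ha N
      set g1 := h * mk (b :: t) * p ^ N with hg1
      set g2 := h * mk ((a.1, !a.2) :: invRev u) * p⁻¹ ^ N with hg2
      have hn1 : N ≤ g1.norm := by
        have := le_length_flatten_replicate (L := p.toWord) (by simp [hw]) N
        rw [norm, h1]
        simp only [List.length_append]
        omega
      have hn2 : N ≤ g2.norm := by
        have := le_length_flatten_replicate (L := p⁻¹.toWord) (by simp [hw']) N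
        rw [norm, h2]
        simp only [List.length_append]
        omega
      have hpm : p = (mk ((a.1, !a.2) :: invRev u))⁻¹ * mk (b :: t) := by
        rw [inv_mk, mul_mk, ← mk_toWord (x := p), hw]
        congr 1
        change _ = FreeGroup.invRev ([(a.1, !a.2)] ++ invRev u) ++ _
        rw [invRev_append, invRev_invRev]
        simp [invRev]
      have hgg : g1 ∈ A ↔ g2 ∈ A := by
        rw [hg1, hg2, hApow, ← hApow N (_ * p⁻¹ ^ N), inv_pow, inv_mul_cancel_right,
          ← hA (h * mk ((a.1, !a.2) :: invRev u)), mul_assoc h, hpm, mul_inv_cancel_left]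
      have hp1 : h.toWord ++ [b] <+: g1.toWord := h1 ▸ List.prefix_append _ _
      have hp2 : h.toWord ++ [(a.1, !a.2)] <+: g2.toWord := h2 ▸ List.prefix_append _ _
      exact ⟨fun hm g h3 h4 => (branch b hb g g1 h3 hp1 h4 hn1).2 (hgg.2 (hm g2 hp2 hn2)),
        fun hm g h3 h4 => (branch _ ha g g2 h3 hp2 h4 hn2).2 (hgg.1 (hm g1 hp1 hn1))⟩

theorem finite_norm_le [Finite α] (M : ℕ) : {g : FreeGroup α | g.norm ≤ M}.Finite :=
  (List.finite_length_le (α × Bool) M).preimage toWord_injective.injOn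

/-- **Whitehead's cut vertex lemma**: the Whitehead graph of a cyclically reduced primitive element
is disconnected or has a cut vertex. -/
theorem not_whiteheadBiconnected_of_primitive [Finite α] {i j : α} (hij : i ≠ j)
    (φ : FreeGroup α ≃* FreeGroup α) (hp : IsCyclicallyReduced (φ (of i)).toWord) :
    ¬ WhiteheadBiconnected (φ (of i)).toWord := by
  intro hW
  set A : Set (FreeGroup α) := {g | (φ.symm g).toWord.head? = some (j, true)} with hAdef
  have hA : ∀ g, g * φ (of i) ∈ A ↔ g ∈ A := by
    intro g
    simpa [hAdef] using head?_toWord_mul_of_eq_iff hij (φ.symm g)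
  obtain ⟨M, hM⟩ := (Set.finite_range fun l : α × Bool => (φ.symm (mk [l])).norm).bddAbove
  obtain ⟨N, hN⟩ := ((finite_norm_le M).image fun g : FreeGroup α => (φ g).norm).bddAbove
  have hcob : ∀ g : FreeGroup α, ∀ l, N + 1 ≤ g.norm → (g * mk [l] ∈ A ↔ g ∈ A) := by
    intro g l hg
    have hM' : (φ.symm (mk [l])).norm ≤ M := hM ⟨l, rfl⟩
    have hlt : (φ.symm (mk [l])).norm < (φ.symm g).norm := by
      by_contra hle
      have := hN ⟨φ.symm g, show (φ.symm g).norm ≤ M by omega, rfl⟩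
      simp only [MulEquiv.apply_symm_apply] at this
      omega
    have := head?_toWord_mul_mk (M := (φ.symm (mk [l])).toWord) hlt
    rw [mk_toWord] at this
    change (φ.symm (g * mk [l])).toWord.head? = _ ↔ (φ.symm g).toWord.head? = _
    rw [_root_.map_mul, this]
  have hpow : Function.Injective fun k : ℕ => (of j : FreeGroup α) ^ k := by
    intro a b hab
    simpa using congrArg norm hab
  have large : ∀ f : ℕ → FreeGroup α, Function.Injective f → ∃ k, N + 1 ≤ (φ (f (k + 1))).norm := by
    intro f hf
    by_contra! hcon
    refine Set.infinite_range_of_injective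
      (φ.injective.comp (hf.comp (add_left_injective 1))) ((finite_norm_le N).subset ?_)
    rintro _ ⟨k, rfl⟩
    exact Nat.lt_succ_iff.1 (hcon k)
  obtain ⟨k, hk⟩ := large _ hpow
  obtain ⟨m, hm⟩ := large _ (inv_injective.comp hpow)
  have := mem_iff_mem_of_whiteheadBiconnected hp hW hA hcob hk hm
  simp [hAdef, toWord_inv, List.replicate_succ' (n := m), invRev,
    List.replicate_succ (n := k)] at this

end FreeGroup

section Cycle

variable {r : ℕ} [NeZero r]

/-- The letters `x_1, x_1⁻¹, x_2, x_2⁻¹, …, x_r, x_r⁻¹` in cyclic order. -/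
def cyclicLetter (r : ℕ) [NeZero r] (k : ℕ) : Fin r × Bool :=
  (Fin.ofNat r (k / 2), decide (k % 2 = 0))

theorem cyclicLetter_eq_iff {k k' : ℕ} :
    cyclicLetter r k = cyclicLetter r k' ↔ k ≡ k' [MOD 2 * r] := by
  rw [Nat.ModEq, Nat.mod_mul, Nat.mod_mul]
  simp only [cyclicLetter, Prod.mk.injEq, Fin.ext_iff, Fin.val_ofNat, decide_eq_decide]
  omega

theorem exists_cyclicLetter_add_eq (d : ℕ) (x : Fin r × Bool) :
    ∃ s < 2 * r, cyclicLetter r (d + s) = x := by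
  have hr : 0 < r := Nat.pos_of_neZero r
  obtain ⟨k, rfl⟩ : ∃ k, cyclicLetter r k = x := by
    obtain ⟨i, _ | _⟩ := x
    · exact ⟨2 * i + 1, by simp [cyclicLetter, Nat.mul_add_div]⟩
    · exact ⟨2 * i, by simp [cyclicLetter]⟩
  refine ⟨(k + (2 * r - 1) * d) % (2 * r), Nat.mod_lt _ (by omega), ?_⟩
  rw [cyclicLetter_eq_iff]
  refine ((Nat.mod_modEq _ _).add_left d).trans ?_
  have : d + (k + (2 * r - 1) * d) = k + 2 * r * d := by
    obtain ⟨m, hm⟩ : ∃ m, 2 * r = m + 1 := ⟨2 * r - 1, by omega⟩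
    rw [hm, Nat.add_sub_cancel]
    ring
  rw [this]
  simp [Nat.ModEq]

/-- A word whose Whitehead graph contains the Hamiltonian cycle
`x_1, x_1⁻¹, x_2, x_2⁻¹, …, x_r, x_r⁻¹` has a biconnected Whitehead graph. -/
theorem whiteheadBiconnected_of_pairs {L : List (Fin r × Bool)}
    (h : ∀ k < r, [(Fin.ofNat r k, true), (Fin.ofNat r k, true)] <:+: L ∧
      [(Fin.ofNat r k, true), (Fin.ofNat r (k + 1), true)] <:+: L) :
    FreeGroup.WhiteheadBiconnected L := by
  intro ok c hok hc
  have edge : ∀ k, ok (cyclicLetter r k) → ok (cyclicLetter r (k + 1)) →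
      (c (cyclicLetter r k) ↔ c (cyclicLetter r (k + 1))) := by
    intro k h1 h2
    have hr : 0 < r := Nat.pos_of_neZero r
    obtain ⟨hl, hl'⟩ := h (k / 2 % r) (Nat.mod_lt _ hr)
    have e1 : Fin.ofNat r (k / 2 % r) = Fin.ofNat r (k / 2) := by simp [Fin.ext_iff]
    have e2 : Fin.ofNat r (k / 2 % r + 1) = Fin.ofNat r (k / 2 + 1) := by simp [Fin.ext_iff]
    rw [e1] at hl hl'
    rw [e2] at hl'
    rcases Nat.mod_two_eq_zero_or_one k with hk | hk
    · have a1 : cyclicLetter r k = (Fin.ofNat r (k / 2), true) := by simp [cyclicLetter, hk]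
      have a2 : cyclicLetter r (k + 1) = (Fin.ofNat r (k / 2), false) := by
        simp only [cyclicLetter, show (k + 1) / 2 = k / 2 by omega,
          show (k + 1) % 2 = 1 by omega]
        rfl
      rw [a1] at h1 ⊢
      rw [a2] at h2 ⊢
      exact (hc _ _ hl h2 h1).symm
    · have a1 : cyclicLetter r k = (Fin.ofNat r (k / 2), false) := by simp [cyclicLetter, hk]
      have a2 : cyclicLetter r (k + 1) = (Fin.ofNat r (k / 2 + 1), true) := by
        simp only [cyclicLetter, show (k + 1) / 2 = k / 2 + 1 by omega,
          show (k + 1) % 2 = 0 by omega]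
        rfl
      rw [a1] at h1 ⊢
      rw [a2] at h2 ⊢
      exact hc _ _ hl' h1 h2
  obtain ⟨d, hd⟩ : ∃ d, ∀ s, 1 ≤ s → s < 2 * r → ok (cyclicLetter r (d + s)) := by
    by_cases hall : ∀ x, ok x
    · exact ⟨0, fun _ _ _ => hall _⟩
    push Not at hall
    obtain ⟨x, hx⟩ := hall
    obtain ⟨d, -, rfl⟩ := exists_cyclicLetter_add_eq 0 x
    refine ⟨0 + d, fun s h1 h2 => ?_⟩
    by_contra hs
    have := cyclicLetter_eq_iff.1 (hok _ _ hs hx)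
    have : s ≡ 0 [MOD 2 * r] := Nat.ModEq.add_left_cancel' (0 + d) this
    rw [Nat.ModEq, Nat.mod_eq_of_lt h2, Nat.zero_mod] at this
    omega
  have path : ∀ s, s + 1 < 2 * r →
      (c (cyclicLetter r (d + 1)) ↔ c (cyclicLetter r (d + (s + 1)))) := by
    intro s
    induction s with
    | zero => simp
    | succ s ih =>
      intro hs
      rw [ih (by omega)]
      exact edge _ (hd _ (by omega) (by omega)) (hd _ (by omega) hs)
  have hall : ∀ x, ok x → (c (cyclicLetter r (d + 1)) ↔ c x) := by
    intro x hx
    have hr : 0 < r := Nat.pos_of_neZero r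
    obtain ⟨s, hs, rfl⟩ := exists_cyclicLetter_add_eq d x
    rcases s with _ | s
    · exact (edge d hx (hd 1 le_rfl (by omega))).symm
    · exact path s hs
  exact fun x y hx hy => (hall x hx).symm.trans (hall y hy)

end Cycle

theorem infix_flatMap_range_replicate {β : Type*} (x : ℕ → β) {n : ℕ} (hn : 2 ≤ n) {m j : ℕ}
    (hj : j < m) :
    [x j, x j] <:+: (List.range m).flatMap (fun i => List.replicate n (x i)) ++ [x m] ∧
    [x j, x (j + 1)] <:+: (List.range m).flatMap (fun i => List.replicate n (x i)) ++ [x m] := by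
  obtain ⟨n, rfl⟩ := Nat.exists_eq_add_of_le' hn
  induction m with
  | zero => omega
  | succ m ih =>
    rw [List.range_succ, List.flatMap_append, List.flatMap_singleton]
    set W := (List.range m).flatMap (fun i => List.replicate (n + 2) (x i))
    rcases Nat.lt_succ_iff_lt_or_eq.1 hj with hj | rfl
    · have hpre : W ++ [x m] <:+: W ++ List.replicate (n + 2) (x m) ++ [x (m + 1)] :=
        ⟨[], List.replicate (n + 1) (x m) ++ [x (m + 1)], by simp [List.replicate_succ]⟩
      exact ⟨(ih hj).1.trans hpre, (ih hj).2.trans hpre⟩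
    · refine ⟨⟨W, List.replicate n (x j) ++ [x (j + 1)], by simp [List.replicate_succ]⟩,
        ⟨W ++ List.replicate (n + 1) (x j), [], by simp [List.replicate_succ' (n := n + 1)]⟩⟩

theorem toWord_prod_gen_pow_mul {r : ℕ} [NeZero r] (n : ℕ) :
    (((List.range r).map (fun j => gen r j ^ n)).prod * gen r 0).toWord =
      (List.range r).flatMap (fun j => List.replicate n (Fin.ofNat r j, true)) ++
        [(Fin.ofNat r r, true)] := by
  have hgen : ∀ j < r, gen r j = FreeGroup.of (Fin.ofNat r j) := by
    intro j hj
    simp only [gen, hj, dif_pos]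
    congr 1
    simp [Fin.ext_iff, Nat.mod_eq_of_lt hj]
  have hprod : ∀ l : List ℕ, (∀ j ∈ l, j < r) → (l.map (fun j => gen r j ^ n)).prod =
      FreeGroup.mk (l.flatMap fun j => List.replicate n (Fin.ofNat r j, true)) := by
    intro l hl
    induction l with
    | nil => rfl
    | cons j l ih =>
      rw [List.map_cons, List.prod_cons, ih fun i hi => hl i (List.mem_cons_of_mem _ hi),
        hgen j (hl j List.mem_cons_self), List.flatMap_cons, ← FreeGroup.mul_mk,
        ← FreeGroup.toWord_of_pow, FreeGroup.mk_toWord]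
  have h0 : gen r 0 = FreeGroup.mk [(Fin.ofNat r r, true)] := by
    rw [hgen 0 (Nat.pos_of_neZero r), FreeGroup.of]
    congr 3
    simp
  rw [hprod _ (by simp), h0, FreeGroup.mul_mk, FreeGroup.toWord_mk]
  have hpos : ∀ a ∈ (List.range r).flatMap (fun j => List.replicate n (Fin.ofNat r j, true)) ++
      [(Fin.ofNat r r, true)], a.2 = true := by
    intro a ha
    simp only [List.mem_append, List.mem_flatMap, List.mem_replicate, List.mem_singleton] at ha
    rcases ha with ⟨_, _, _, rfl⟩ | rfl <;> rfl
  exact FreeGroup.IsReduced.reduce_eq (List.Pairwise.isChain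
    (List.pairwise_iff_forall_sublist.2 fun {a b} hab _ => by
      rw [hpos a (hab.subset (by simp)), hpos b (hab.subset (by simp))]))

theorem CyclicallyReduced.isCyclicallyReduced {r : ℕ} {p : FG r} (h : CyclicallyReduced p) :
    FreeGroup.IsCyclicallyReduced p.toWord := by
  refine ⟨FreeGroup.isReduced_toWord, fun a ha b hb hab => ?_⟩
  by_contra hne
  exact h b hb a ha (Prod.ext hab.symm (Bool.eq_not.2 (Ne.symm hne)))

/-- In `F_r` (`r ≥ 2`), the word `x_1^n x_2^n ⋯ x_r^n x_1` is
primitivity-blocking for every `n ≥ 2`. -/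
theorem pb_x1n_dots_xrn_x1 {r : ℕ} (hr : 2 ≤ r) (n : ℕ) (hn : 2 ≤ n) :
    PrimitivityBlocking (by omega)
      (((List.range r).map (fun j => gen r j ^ n)).prod * gen r 0) := by
  have : NeZero r := ⟨by omega⟩
  rintro _ ⟨φ, rfl⟩ hp hv
  refine FreeGroup.not_whiteheadBiconnected_of_primitive (i := (⟨0, by omega⟩ : Fin r))
    (j := ⟨1, by omega⟩) (by simp) φ hp.isCyclicallyReduced
    (whiteheadBiconnected_of_pairs fun k hk => ?_)
  rw [toWord_prod_gen_pow_mul] at hv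
  have := infix_flatMap_range_replicate (fun j => (Fin.ofNat r j, true)) hn hk
  exact ⟨this.1.trans hv, this.2.trans hv⟩
end

section
/- Let r ≤ n and let ι: F_r → F_n be the natural embedding sending x_i to x_i for 1 ≤ i ≤ r. If u ∈ F_r is such that α(ι(u)) is positive for some automorphism α of F_n, then u is potentially positive in F_r, i.e., β(u) is positive for some automorphism β of F_r. -/
theorem map_mem_closure_range {M N ι κ : Type*} [Monoid M] [Monoid N] (f : M →* N) {b : ι → M}
    {c : κ → N} (hf : ∀ i, f (b i) ∈ Set.range c) {x : M}
    (hx : x ∈ Submonoid.closure (Set.range b)) : f x ∈ Submonoid.closure (Set.range c) := by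
  have : Submonoid.closure (Set.range b) ≤ (Submonoid.closure (Set.range c)).comap f :=
    Submonoid.closure_le.mpr (by rintro _ ⟨i, rfl⟩; exact Submonoid.subset_closure (hf i))
  exact this hx

section VertexGroup

universe u

open CategoryTheory Quiver IsFreeGroupoid

/-- The loop at `r` obtained by conjugating an arrow with chosen arrows out of `r`. -/
noncomputable def conjLoop {G : Type u} [Groupoid.{u} G] {r : G} (t : ∀ a, r ⟶ a)
    {a b : G} (p : a ⟶ b) : End r :=
  t a ≫ p ≫ Groupoid.inv (t b)

theorem conjLoop_id {G : Type u} [Groupoid.{u} G] {r : G} (t : ∀ a, r ⟶ a) (a : G) :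
    conjLoop t (𝟙 a) = 1 := by
  simp [conjLoop, End.one_def]

theorem conjLoop_comp {G : Type u} [Groupoid.{u} G] {r : G} (t : ∀ a, r ⟶ a) {a b c : G}
    (p : a ⟶ b) (q : b ⟶ c) : conjLoop t (p ≫ q) = conjLoop t q * conjLoop t p := by
  simp [conjLoop, End.mul_def]

theorem conjLoop_end {G : Type u} [Groupoid.{u} G] {r : G} (t : ∀ a, r ⟶ a) (ht : t r = 𝟙 r)
    (p : End r) : conjLoop t p = p := by
  simp [conjLoop, ht]

/-- A monoid homomorphism out of a vertex group, extended to the groupoid along `conjLoop`. -/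
noncomputable def conjFunctor {G : Type u} [Groupoid.{u} G] {r : G} (t : ∀ a, r ⟶ a)
    {X : Type u} [Group X] (E : End r →* X) : G ⥤ CategoryTheory.SingleObj X where
  obj _ := ()
  map p := E (conjLoop t p)
  map_id a := by rw [conjLoop_id, E.map_one]; rfl
  map_comp p q := by rw [conjLoop_comp, E.map_mul]; rfl

/-- The loops attached to the generating arrows outside a tree `S` satisfy the universal property
of a free basis of the vertex group. The tree is given by arrows `t` out of the root that are
killed by every functor killing `S`. -/
theorem existsUnique_lift_end {G : Type u} [Groupoid.{u} G] [IsFreeGroupoid G] {r : G}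
    (t : ∀ a, r ⟶ a) (ht : t r = 𝟙 r) (S : Set (Quiver.Total (Generators G)))
    (hS : ∀ e ∈ S, conjLoop t (of e.hom) = 1)
    (hF : ∀ (X : Type u) [Group X] (F : G ⥤ CategoryTheory.SingleObj X),
      (∀ e ∈ S, F.map (of e.hom) = (1 : X)) → ∀ a, F.map (t a) = (1 : X))
    {X : Type u} [Group X] (f : ↥Sᶜ → X) :
    ∃! F : End r →* X, ∀ e : ↥Sᶜ, F (conjLoop t (of e.val.hom)) = f e := by
  classical
  obtain ⟨F, hFf, hu⟩ := unique_lift (G := G) (X := X) fun a b e =>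
    if h : (⟨a, b, e⟩ : Quiver.Total (Generators G)) ∈ S then 1 else f ⟨⟨a, b, e⟩, h⟩
  have key : ∀ a, F.map (t a) = (1 : X) := hF X F fun e he => (hFf _ _ _).trans (dif_pos he)
  have hinv (a : G) : F.map (Groupoid.inv (t a)) = (1 : X) := by
    have h : (F.map (Groupoid.inv (t a)) : X) * F.map (t a) = F.map (𝟙 r) := by
      rw [← Groupoid.comp_inv (t a)]; exact (F.map_comp _ _).symm
    rw [key, mul_one] at h
    exact h.trans (F.map_id r)
  let F₀ : End r →* X :=
    { toFun p := F.map p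
      map_one' := F.map_id r
      map_mul' p q := F.map_comp q p }
  refine ⟨F₀, ?_, ?_⟩
  · rintro ⟨⟨a, b, e⟩, h⟩
    refine Eq.trans ?_ ((hFf _ _ _).trans (dif_neg h))
    refine (F.map_comp _ _).trans ?_
    refine (congrArg₂ (fun x y : X => x * y) (F.map_comp _ _) (key _)).trans ?_
    refine (mul_one _).trans ?_
    exact (congrArg₂ (fun x y : X => x * y) (hinv _) rfl).trans (one_mul _)
  · intro E hE
    have : conjFunctor t E = F := by
      apply hu
      intro a b e
      change E (conjLoop t (of e)) = dite _ _ _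
      split_ifs with h
      · rw [hS _ h, E.map_one]
      · exact hE ⟨⟨a, b, e⟩, h⟩
    ext x
    change E x = F.map x
    rw [← this]
    exact congrArg E (conjLoop_end t ht x).symm

theorem map_treeHom {G : Type u} [Groupoid.{u} G] [IsFreeGroupoid G]
    (T : WideSubquiver (Symmetrify <| Generators G)) [Arborescence T]
    {X : Type u} [Group X] (F : G ⥤ CategoryTheory.SingleObj X)
    (hF : ∀ (a b : Generators G) (e : a ⟶ b), e ∈ wideSubquiverSymmetrify T a b →
      F.map (of e) = (1 : X)) (a : G) : F.map (SpanningTree.treeHom T a) = (1 : X) := by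
  suffices ∀ {a : G} (p : Path (root T) a), F.map (SpanningTree.homOfPath T p) = (1 : X) from
    this _
  intro a p
  induction p with
  | nil => exact F.map_id _
  | cons p e ih =>
    refine (F.map_comp (SpanningTree.homOfPath T p) _).trans ?_
    refine (congrArg₂ (fun x y : X => x * y) ?_ ih).trans (mul_one (1 : X))
    rcases e with ⟨e | e, eT⟩
    · exact hF _ _ _ (Or.inl eT)
    · exact (F.map_inv _).trans ((SingleObj.inv_as_inv ..).trans
        (inv_eq_one.mpr (hF _ _ _ (Or.inr eT))))

/-- A vertex group of a connected free groupoid has a basis such that every generating arrow gives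
a loop that is trivial or in the basis. -/
theorem exists_basis_end {G : Type u} [Groupoid.{u} G] [IsFreeGroupoid G] [IsConnected G] (r : G) :
    ∃ (t : ∀ a, r ⟶ a) (S : Type u) (B : FreeGroupBasis S (End r)), t r = 𝟙 r ∧
      ∀ (a b : Generators G) (e : a ⟶ b),
        conjLoop t (of e) = 1 ∨ conjLoop t (of e) ∈ Set.range B := by
  have : RootedConnected (V := Symmetrify (Generators G)) r := generators_connected G r
  let T := geodesicSubtree (V := Symmetrify (Generators G)) r
  let _ : Arborescence T := Quiver.geodesicArborescence _
  let t : ∀ a, r ⟶ a := SpanningTree.treeHom T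
  have ht : t r = 𝟙 r := SpanningTree.treeHom_root T
  let S : Set (Quiver.Total (Generators G)) :=
    wideSubquiverEquivSetTotal (wideSubquiverSymmetrify T)
  have hS : ∀ e ∈ S, conjLoop t (of e.hom) = 1 := fun e he => 
    (congrArg (fun x => t e.left ≫ of e.hom ≫ x) (Groupoid.inv_eq_inv (t e.right))).trans
      (SpanningTree.loopOfHom_eq_id T e.hom he)
  refine ⟨t, ↥Sᶜ, FreeGroupBasis.ofUniqueLift ↥Sᶜ (fun e => conjLoop t (of e.val.hom)) fun f =>
    existsUnique_lift_end t ht S hS (fun X _ F h => ?_) f, ht, fun a b e => ?_⟩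
  · exact map_treeHom T F fun a b e he => h ⟨a, b, e⟩ he
  · by_cases h : (⟨a, b, e⟩ : Quiver.Total _) ∈ S
    · exact .inl (hS _ h)
    · refine .inr ⟨⟨⟨a, b, e⟩, h⟩, ?_⟩
      exact FreeGroup.lift_apply_of ..

/-- A subgroup of a free group has a basis in which all its positive elements are positive. -/
theorem exists_basis_mem_closure {F : Type u} [Group F] [IsFreeGroup F] (H : Subgroup F) :
    ∃ (S : Type u) (B : FreeGroupBasis S H), ∀ h : H,
      (h : F) ∈ Submonoid.closure (Set.range (IsFreeGroup.of (G := F))) →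
        h ∈ Submonoid.closure (Set.range B) := by
  let r : ActionCategory F (F ⧸ H) := ActionCategory.objEquiv F (F ⧸ H) ↑(1 : F)
  have : @IsConnected (ActionCategory F (F ⧸ H)) Groupoid.toCategory :=
    (inferInstance : IsConnected (ActionCategory F (F ⧸ H)))
  obtain ⟨t, S, B, ht, hB⟩ := exists_basis_end r
  let φ := ActionCategory.endMulEquivSubgroup H
  have key : ∀ g ∈ Submonoid.closure (Set.range (IsFreeGroup.of (G := F))),
      ∀ (a b : ActionCategory F (F ⧸ H)) (h : g • a.back = b.back),
        conjLoop t (⟨g, h⟩ : a ⟶ b) ∈ Submonoid.closure (Set.range B) := by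
    intro g hg
    induction hg using Submonoid.closure_induction with
    | mem g hg =>
      obtain ⟨i, rfl⟩ := hg
      intro a b h
      rcases hB a b ⟨i, h⟩ with h₁ | h₁
      · exact (show conjLoop t (⟨IsFreeGroup.of i, h⟩ : a ⟶ b) = 1 from h₁) ▸ one_mem _
      · exact Submonoid.subset_closure h₁
    | one =>
      intro a b h
      obtain rfl : a = b := (ActionCategory.objEquiv F (F ⧸ H)).symm.injective
        ((one_smul F a.back).symm.trans h)
      exact (conjLoop_id t a) ▸ one_mem _
    | mul g₁ g₂ _ _ h₁ h₂ =>
      intro a b h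
      let c : ActionCategory F (F ⧸ H) := ActionCategory.objEquiv F (F ⧸ H) (g₂ • a.back)
      let p : a ⟶ c := ⟨g₂, rfl⟩
      let q : c ⟶ b := ⟨g₁, (mul_smul g₁ g₂ a.back).symm.trans h⟩
      exact (conjLoop_comp t p q) ▸ mul_mem (h₁ c b q.2) (h₂ a c p.2)
  refine ⟨S, B.map φ, fun h hh => ?_⟩
  have h₁ : φ.symm h ∈ Submonoid.closure (Set.range B) :=
    (conjLoop_end t ht (φ.symm h)) ▸ key h hh r r (φ.symm h).2
  exact (φ.apply_symm_apply h) ▸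
    map_mem_closure_range φ.toMonoidHom (c := B.map φ) (fun s => ⟨s, rfl⟩) h₁

end VertexGroup

theorem positive_iff_mem_closure {r : ℕ} {u : FG r} :
    Positive u ↔ u ∈ Submonoid.closure (Set.range (FreeGroup.of (α := Fin r))) := by
  constructor
  · intro hu
    have key (L : List (Fin r × Bool)) (hL : ∀ l ∈ L, l.2 = true) :
        FreeGroup.mk L ∈ Submonoid.closure (Set.range (FreeGroup.of (α := Fin r))) := by
      induction L with
      | nil => exact one_mem _
      | cons l L ih =>
        obtain ⟨i, b⟩ := l
        obtain rfl : b = true := hL (i, b) (by simp)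
        exact mul_mem (Submonoid.subset_closure (Set.mem_range_self i))
          (ih fun l hl => hL l (List.mem_cons_of_mem _ hl))
    exact FreeGroup.mk_toWord (x := u) ▸ key _ hu
  · intro hu
    induction hu using Submonoid.closure_induction with
    | mem x hx => obtain ⟨i, rfl⟩ := hx; simp [Positive]
    | one => simp [Positive]
    | mul x y _ _ hx hy =>
      intro l hl
      rcases List.mem_append.mp ((FreeGroup.toWord_mul_sublist x y).subset hl) with h | h
      exacts [hx l h, hy l h]

theorem exists_positive_of_injective {r n : ℕ} (f : FG r →* FG n) (hf : Function.Injective f)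
    {u : FG r} (hu : Positive (f u)) : ∃ β : FG r ≃* FG r, Positive (β u) := by
  let e : Fin n ≃ IsFreeGroup.Generators (FG n) :=
    Equiv.ofFreeGroupEquiv (IsFreeGroup.toFreeGroup (FG n))
  let γ : FG n ≃* FG n :=
    (FreeGroup.freeGroupCongr e).trans (IsFreeGroup.toFreeGroup (FG n)).symm
  let f' : FG r →* FG n := γ.toMonoidHom.comp f
  have hf' : Function.Injective f' := γ.injective.comp hf
  let ψ : FG r ≃* f'.range := MonoidHom.ofInjective hf'
  obtain ⟨S, B, hB⟩ := exists_basis_mem_closure f'.range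
  have hS := hB (ψ u) (map_mem_closure_range γ.toMonoidHom (fun i => ⟨e i, by
    simp [γ, IsFreeGroup.of]⟩) (positive_iff_mem_closure.mp hu))
  let s : S ≃ Fin r := (Equiv.ofFreeGroupEquiv (ψ.trans B.repr)).symm
  refine ⟨ψ.trans (B.reindex s).repr, positive_iff_mem_closure.mpr ?_⟩
  refine map_mem_closure_range (B.reindex s).repr.toMonoidHom (fun i => ⟨s i, ?_⟩) hS
  have : B i = B.reindex s (s i) := by simp
  rw [this]
  exact ((B.reindex s).repr_apply_coe (s i)).symm

/-- If `r ≤ n` and `ι : F_r → F_n` is the natural embedding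
`x_i ↦ x_i`, and `α(ι(u))` is positive for some automorphism `α` of `F_n`, then `u` is
potentially positive in `F_r`. -/
theorem potentially_positive_of_stably {r n : ℕ} (h : r ≤ n) (u : FG r)
    (hpp : ∃ α : FG n ≃* FG n, Positive (α (FreeGroup.map (Fin.castLE h) u))) :
    ∃ β : FG r ≃* FG r, Positive (β u) := by
  obtain ⟨α, hα⟩ := hpp
  exact exists_positive_of_injective (α.toMonoidHom.comp (FreeGroup.map (Fin.castLE h)))
    (α.injective.comp (FreeGroup.map_injective (Fin.castLE_injective h))) hα
end

section
/- Let r ≥ 2 and let u ∈ F_r be an element such that for some index j, no generator other than x_j occurs with a negative exponent in the reduced word of u (i.e., for every i ≠ j the letter x_i⁻¹ does not occur in the reduced word of u). Then u is potentially positive. -/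
theorem Positive.mul_s14 {r : ℕ} {u v : FG r} (hu : Positive u) (hv : Positive v) :
    Positive (u * v) := by
  intro l hl
  rcases List.mem_append.mp ((FreeGroup.toWord_mul_sublist u v).subset hl) with h | h
  exacts [hu l h, hv l h]

theorem positive_of {r : ℕ} (i : Fin r) : Positive (FreeGroup.of i) := by
  simp [Positive]

theorem positive_of_zpow {r : ℕ} (i : Fin r) {c : ℤ} (hc : 0 ≤ c) :
    Positive (FreeGroup.of i ^ c) := by
  lift c to ℕ using hc
  intro l hl
  rw [zpow_natCast, FreeGroup.toWord_of_pow] at hl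
  rw [List.eq_of_mem_replicate hl]

/-- The endomorphism fixing `x_j` and sending `x_i` to `x_j ^ k * x_i * x_j ^ k` for `i ≠ j`. -/
def shearHom {r : ℕ} (j : Fin r) (k : ℤ) : FG r →* FG r :=
  FreeGroup.lift fun i => if i = j then FreeGroup.of j else
    FreeGroup.of j ^ k * FreeGroup.of i * FreeGroup.of j ^ k

theorem shearHom_of_self {r : ℕ} (j : Fin r) (k : ℤ) :
    shearHom j k (FreeGroup.of j) = FreeGroup.of j := by
  simp [shearHom]

theorem shearHom_of_ne {r : ℕ} {i j : Fin r} (hij : i ≠ j) (k : ℤ) :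
    shearHom j k (FreeGroup.of i) = FreeGroup.of j ^ k * FreeGroup.of i * FreeGroup.of j ^ k := by
  simp [shearHom, hij]

theorem shearHom_neg_comp {r : ℕ} (j : Fin r) (k : ℤ) :
    (shearHom j (-k)).comp (shearHom j k) = MonoidHom.id (FG r) := by
  ext i
  by_cases hij : i = j
  · subst hij
    simp [shearHom_of_self]
  · simp [shearHom_of_self, shearHom_of_ne hij, mul_assoc]

/-- The automorphism fixing `x_j` and sending `x_i` to `x_j ^ k * x_i * x_j ^ k` for `i ≠ j`. -/
def shearEquiv {r : ℕ} (j : Fin r) (k : ℤ) : FG r ≃* FG r :=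
  (shearHom j k).toMulEquiv (shearHom j (-k)) (shearHom_neg_comp j k)
    (by simpa using shearHom_neg_comp j (-k))

theorem shearEquiv_of_self {r : ℕ} (j : Fin r) (k : ℤ) :
    shearEquiv j k (FreeGroup.of j) = FreeGroup.of j :=
  shearHom_of_self j k

theorem shearEquiv_of_ne {r : ℕ} {i j : Fin r} (hij : i ≠ j) (k : ℤ) :
    shearEquiv j k (FreeGroup.of i) =
      FreeGroup.of j ^ k * FreeGroup.of i * FreeGroup.of j ^ k :=
  shearHom_of_ne hij k

theorem lift_inv_of_comp_self (r : ℕ) :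
    (FreeGroup.lift fun i : Fin r => (FreeGroup.of i)⁻¹).comp
      (FreeGroup.lift fun i : Fin r => (FreeGroup.of i)⁻¹) = MonoidHom.id (FG r) := by
  ext i
  simp

/-- The automorphism inverting every generator. -/
def invGenEquiv (r : ℕ) : FG r ≃* FG r :=
  MonoidHom.toMulEquiv _ _ (lift_inv_of_comp_self r) (lift_inv_of_comp_self r)

theorem invGenEquiv_of {r : ℕ} (i : Fin r) :
    invGenEquiv r (FreeGroup.of i) = (FreeGroup.of i)⁻¹ :=
  show FreeGroup.lift (fun i : Fin r => (FreeGroup.of i)⁻¹) (FreeGroup.of i) = _ from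
    FreeGroup.lift_apply_of

/-- If only `x_j` occurs with negative exponent in the word `L`, and `k` is at least the length of
`L`, then the shear by `k` sends `L` to a power of `x_j`, or to a positive element multiplied on
the left by a nonnegative power of `x_j`. -/
theorem shearEquiv_mk_of_one_negative_generator {r : ℕ} (j : Fin r) (k : ℕ)
    (L : List (Fin r × Bool)) (hL : L.length ≤ k) (h : ∀ l ∈ L, l.1 ≠ j → l.2 = true) :
    ∃ c : ℤ,
      (-(L.length : ℤ) ≤ c ∧ shearEquiv j k (FreeGroup.mk L) = FreeGroup.of j ^ c) ∨
      ∃ m, Positive m ∧ (k : ℤ) - L.length ≤ c ∧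
        shearEquiv j k (FreeGroup.mk L) = FreeGroup.of j ^ c * m := by
  induction L with
  | nil => exact ⟨0, .inl ⟨by simp, by simp [← FreeGroup.one_eq_mk]⟩⟩
  | cons l L ih =>
    obtain ⟨i, b⟩ := l
    rw [List.length_cons] at hL
    have hcons : FreeGroup.mk ((i, b) :: L) = FreeGroup.mk [(i, b)] * FreeGroup.mk L := by
      simp [FreeGroup.mul_mk]
    obtain ⟨c, hc⟩ := ih (by omega) fun l hl => h l (List.mem_cons_of_mem _ hl)
    rw [hcons, map_mul, List.length_cons]
    push_cast
    by_cases hij : i = j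
    · subst hij
      obtain ⟨e, he, hle⟩ : ∃ e : ℤ,
          shearEquiv i k (FreeGroup.mk [(i, b)]) = FreeGroup.of i ^ e ∧ -1 ≤ e := by
        cases b
        · refine ⟨-1, ?_, le_rfl⟩
          have hinv : FreeGroup.mk [(i, false)] = (FreeGroup.of i)⁻¹ := rfl
          rw [hinv, map_inv, shearEquiv_of_self, zpow_neg_one]
        · exact ⟨1, (shearEquiv_of_self i k).trans (zpow_one _).symm, by norm_num⟩
      refine ⟨e + c, ?_⟩
      rcases hc with ⟨hc, hu⟩ | ⟨m, hm, hc, hu⟩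
      · exact .inl ⟨by omega, by rw [he, hu, zpow_add]⟩
      · exact .inr ⟨m, hm, by omega, by rw [he, hu, zpow_add, mul_assoc]⟩
    · obtain rfl : b = true := h (i, b) List.mem_cons_self hij
      have hi : shearEquiv j k (FreeGroup.mk [(i, true)]) = _ := shearEquiv_of_ne hij k
      refine ⟨k, .inr ?_⟩
      rw [hi]
      rcases hc with ⟨hc, hu⟩ | ⟨m, hm, hc, hu⟩
      · refine ⟨FreeGroup.of i * FreeGroup.of j ^ (k + c),
          (positive_of i).mul_s14 (positive_of_zpow j (by omega)), by omega, ?_⟩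
        rw [hu, zpow_add]
        group
      · refine ⟨FreeGroup.of i * (FreeGroup.of j ^ (k + c) * m),
          (positive_of i).mul_s14 ((positive_of_zpow j (by omega)).mul_s14 hm), by omega, ?_⟩
        rw [hu, zpow_add]
        group

/-- For `r ≥ 2`, if in the reduced word of `u` no generator other
than `x_j` occurs with a negative exponent, then `u` is potentially positive. -/
theorem potentially_positive_of_one_negative_generator {r : ℕ} (hr : 2 ≤ r)
    (u : FG r) (j : Fin r) (h : ∀ l ∈ u.toWord, l.1 ≠ j → l.2 = true) :
    ∃ α : FG r ≃* FG r, Positive (α u) := by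
  obtain ⟨c, hc | ⟨m, hm, hc, hum⟩⟩ :=
    shearEquiv_mk_of_one_negative_generator j u.toWord.length u.toWord le_rfl h
  · rw [FreeGroup.mk_toWord] at hc
    obtain hc0 | hc0 := le_total 0 c
    · exact ⟨shearEquiv j u.toWord.length, hc.2 ▸ positive_of_zpow j hc0⟩
    · refine ⟨(shearEquiv j u.toWord.length).trans (invGenEquiv _), ?_⟩
      rw [MulEquiv.trans_apply, hc.2, map_zpow, invGenEquiv_of, inv_zpow']
      exact positive_of_zpow j (neg_nonneg.mpr hc0)
  · rw [FreeGroup.mk_toWord] at hum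
    exact ⟨shearEquiv j u.toWord.length,
      hum ▸ (positive_of_zpow j (by omega)).mul_s14 hm⟩
end
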